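/- arXiv:2310.17065 — 9 statements merged into one kernel-verified Lean document; each statement's English description precedes it below -/
import Mathlib

section
/- Let n ≥ 2 be an integer, let G be a (not necessarily abelian) group of order n, and let a_1, …, a_{2n-1} be a sequence of 2n−1 elements of G. Then there exist n pairwise distinct indices i_1, …, i_n ∈ {1, …, 2n−1} such that the ordered product a_{i_1} · a_{i_2} ⋯ a_{i_n} equals the identity element 1 of G. (Formally: there is an injective map σ : Fin n → Fin (2n−1) such that the product of the list a(σ 0), a(σ 1), …, a(σ (n−1)), taken in this order, equals 1.) -/
open Finset
open scoped Pointwise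

theorem Finset.card_filter_add_card_union_image {α : Type*} [DecidableEq α] (s : Finset α)
    {f : α → α} (hf : Function.Injective f) :
    #{x ∈ s | f x ∈ s} + #(s ∪ s.image f) = 2 * #s := by
  have h : image f {x ∈ s | f x ∈ s} = s ∩ s.image f := by
    ext y
    simp only [mem_image, mem_filter, mem_inter]
    constructor
    · rintro ⟨x, ⟨hx, hfx⟩, rfl⟩
      exact ⟨hfx, x, hx, rfl⟩
    · rintro ⟨hy, x, hx, rfl⟩
      exact ⟨x, ⟨hx, hy⟩, rfl⟩
  have h₁ := card_inter_add_card_union s (s.image f)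
  rw [← h, card_image_of_injective _ hf, card_image_of_injective _ hf] at h₁
  omega

/-- **Kemperman's theorem**, normalized so that the uniquely represented element is `1 = 1 * 1`. -/
theorem Finset.card_add_card_le_of_mul_eq_one {G : Type*} [Group G] [DecidableEq G]
    (A B C : Finset G) (hA : 1 ∈ A) (hB : 1 ∈ B) (hC : A * B ⊆ C)
    (h : ∀ a ∈ A, ∀ b ∈ B, a * b = 1 → a = 1) : #A + #B ≤ #C + 1 := by
  have hAC : A ⊆ C := fun a ha => hC (by simpa using mul_mem_mul ha hB)
  have hBC : B ⊆ C := fun b hb => hC (by simpa using mul_mem_mul hA hb)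
  by_cases hAB : A ∩ B ⊆ {1}
  · have h₁ := card_union_add_card_inter A B
    have h₂ := card_le_card (union_subset hAC hBC)
    have h₃ := card_le_card hAB
    rw [card_singleton] at h₃
    omega
  obtain ⟨e, he, he₁⟩ := not_subset.1 hAB
  obtain ⟨heA, heB⟩ := mem_inter.1 he
  rw [mem_singleton] at he₁
  have heA' : e⁻¹ ∉ A := fun H => he₁ (inv_eq_one.1 (h _ H _ heB (inv_mul_cancel e)))
  have heB' : e⁻¹ ∉ B := fun H => he₁ (h _ heA _ H (mul_inv_cancel e))
  have hcA := card_filter_add_card_union_image A (mul_left_injective e)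
  have hcB := card_filter_add_card_union_image B (mul_right_injective e)
  have hlt : #{x ∈ A | x * e ∈ A} < #A := by
    refine card_lt_card ((filter_subset _ _).ssubset_of_ne fun H => heA' ?_)
    have hpow : ∀ k : ℕ, e ^ k ∈ A := by
      intro k
      induction k with
      | zero => simpa using hA
      | succ k ih =>
        rw [← H] at ih
        simpa [pow_succ] using (mem_filter.1 ih).2
    have hfin : IsOfFinOrder e := by
      by_contra hinf
      exact Set.infinite_of_injective_forall_mem (injective_pow_iff_not_isOfFinOrder.2 hinf) hpow
        A.finite_toSet
    obtain ⟨k, hk⟩ := hfin.mem_powers_iff_mem_zpowers.2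
      (inv_mem (Subgroup.mem_zpowers e))
    exact hk ▸ hpow k
  have hAC' := card_le_card hAC
  have hBC' := card_le_card hBC
  by_cases hcard : #A + #B ≤ #{x ∈ A | x * e ∈ A} + #(B ∪ B.image (e * ·))
  · refine hcard.trans (card_add_card_le_of_mul_eq_one _ _ C ?_ ?_ ?_ ?_)
    · simpa using ⟨hA, heA⟩
    · exact mem_union_left _ hB
    · rw [mul_subset_iff]
      intro x hx y hy
      obtain ⟨hx, hxe⟩ := mem_filter.1 hx
      rcases mem_union.1 hy with hy | hy
      · exact hC (mul_mem_mul hx hy)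
      · obtain ⟨b, hb, rfl⟩ := mem_image.1 hy
        rw [← mul_assoc]
        exact hC (mul_mem_mul hxe hb)
    · intro x hx y hy hxy
      obtain ⟨hx, hxe⟩ := mem_filter.1 hx
      rcases mem_union.1 hy with hy | hy
      · exact h x hx y hy hxy
      · obtain ⟨b, hb, rfl⟩ := mem_image.1 hy
        rw [← mul_assoc] at hxy
        have := h _ hxe _ hb hxy
        exact absurd (eq_inv_of_mul_eq_one_left this ▸ hx) heA'
  · have hsum : #A + #B < #(A ∪ A.image (· * e)) + #{x ∈ B | e * x ∈ B} := by omega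
    refine hsum.le.trans (card_add_card_le_of_mul_eq_one _ _ C ?_ ?_ ?_ ?_)
    · exact mem_union_left _ hA
    · simpa using ⟨hB, heB⟩
    · rw [mul_subset_iff]
      intro x hx y hy
      obtain ⟨hy, hye⟩ := mem_filter.1 hy
      rcases mem_union.1 hx with hx | hx
      · exact hC (mul_mem_mul hx hy)
      · obtain ⟨b, hb, rfl⟩ := mem_image.1 hx
        rw [mul_assoc]
        exact hC (mul_mem_mul hb hye)
    · intro x hx y hy hxy
      obtain ⟨hy, hye⟩ := mem_filter.1 hy
      rcases mem_union.1 hx with hx | hx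
      · exact h x hx y hy hxy
      · obtain ⟨b, hb, rfl⟩ := mem_image.1 hx
        rw [mul_assoc] at hxy
        have hb1 := h _ hb _ hye hxy
        rw [hb1, one_mul] at hxy
        exact absurd (eq_inv_of_mul_eq_one_right hxy ▸ hy) heB'
termination_by (2 * #C - (#A + #B), #A)
decreasing_by
  · rw [Prod.lex_def]
    dsimp only
    omega
  · rw [Prod.lex_def]
    dsimp only
    have h₁ := card_le_card (show A ∪ A.image (· * e) ⊆ C from
      union_subset hAC (image_subset_iff.2 fun a ha => hC (mul_mem_mul ha heB)))
    have h₂ := card_le_card (filter_subset (e * · ∈ B) B)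
    omega

/-- **Kemperman's theorem**: `#(A * B) ≥ #A + #B - 1` if some element of `A * B` has a unique
representation. -/
theorem Finset.card_add_card_le_of_uniqueMul {G : Type*} [Group G] [DecidableEq G]
    {A B : Finset G} {a₀ b₀ : G} (ha₀ : a₀ ∈ A) (hb₀ : b₀ ∈ B) (h : UniqueMul A B a₀ b₀) :
    #A + #B ≤ #(A * B) + 1 := by
  have key := card_add_card_le_of_mul_eq_one (A.image (a₀⁻¹ * ·)) (B.image (· * b₀⁻¹))
    ((A * B).image (a₀⁻¹ * · * b₀⁻¹)) (mem_image.2 ⟨a₀, ha₀, by simp⟩)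
    (mem_image.2 ⟨b₀, hb₀, by simp⟩) ?_ ?_
  · rw [card_image_of_injective _ (mul_right_injective _),
      card_image_of_injective _ (mul_left_injective _)] at key
    exact key.trans (Nat.add_le_add_right card_image_le 1)
  · rw [mul_subset_iff]
    simp only [mem_image]
    rintro _ ⟨a, ha, rfl⟩ _ ⟨b, hb, rfl⟩
    exact ⟨a * b, mul_mem_mul ha hb, by group⟩
  · simp only [mem_image]
    rintro _ ⟨a, ha, rfl⟩ _ ⟨b, hb, rfl⟩ hab
    have : a * b = a₀ * b₀ := by
      rwa [mul_assoc, inv_mul_eq_one, ← mul_assoc, eq_mul_inv_iff_mul_eq, eq_comm] at hab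
    rw [(h ha hb this).1, inv_mul_cancel]

theorem Finset.sum_card_sub_one_lt_card_prod_ofFn {G : Type*} [Group G] [DecidableEq G] {k : ℕ}
    (x : Fin k → G) (B : Fin k → Finset G) (hx : ∀ i, x i ∈ B i)
    (h : ∀ y : Fin k → G, (∀ i, y i ∈ B i) → (List.ofFn y).prod = (List.ofFn x).prod → y = x) :
    ∑ i, (#(B i) - 1) < #(List.ofFn B).prod := by
  induction k with
  | zero => simp
  | succ k ih =>
    have ih := ih (fun i => x i.succ) (fun i => B i.succ) (fun i => hx _) fun y hy hyx => by
      have := h (Fin.cons (x 0) y) (Fin.cases (by simpa using hx 0) (by simpa using hy))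
        (by simp [List.ofFn_succ, hyx])
      ext i
      simpa using congrFun this i.succ
    have key := card_add_card_le_of_uniqueMul (A := B 0)
      (B := (List.ofFn fun i => B (Fin.succ i)).prod)
      (b₀ := (List.ofFn fun i => x (Fin.succ i)).prod) (hx 0)
      (mem_prod_list_ofFn.2 ⟨fun i => ⟨_, hx i.succ⟩, rfl⟩) fun a b ha hb hab => by
        obtain ⟨y, rfl⟩ := mem_prod_list_ofFn.1 hb
        have := h (Fin.cons a fun i => y i) (Fin.cases (by simpa using ha) (by simp))
          (by simpa [List.ofFn_succ] using hab)
        have h0 : a = x 0 := by simpa using congrFun this 0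
        exact ⟨h0, by simpa [h0] using hab⟩
    have := card_pos.2 ⟨_, hx 0⟩
    rw [Fin.sum_univ_succ, List.ofFn_succ, List.prod_cons]
    omega

theorem Finset.exists_injOn_of_card_le {α β : Type*} [Nonempty β] {s : Finset α} {t : Finset β}
    (h : #s ≤ #t) : ∃ f : α → β, (∀ x ∈ s, f x ∈ t) ∧ Set.InjOn f s := by
  have hle : (s : Set α).encard ≤ (t : Set β).encard := by
    simpa only [Set.encard_coe_eq_coe_finsetCard, Nat.cast_le] using h
  obtain ⟨f, hf, hinj⟩ := s.finite_toSet.exists_injOn_of_encard_le hle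
  exact ⟨f, fun x hx => hf hx, hinj⟩

/-- A colouring with colours in `Z` that is injective on each fiber of `a`. -/
theorem Finset.exists_coloring_of_card_fiber_le {ι κ G : Type*} [DecidableEq G] [Nonempty κ]
    (R : Finset ι) (Z : Finset κ) (a : ι → G) (h : ∀ v, #{i ∈ R | a i = v} ≤ #Z) :
    ∃ c : ι → κ, (∀ i ∈ R, c i ∈ Z) ∧ ∀ i ∈ R, ∀ j ∈ R, c i = c j → a i = a j → i = j := by
  choose c hcZ hc using fun v => exists_injOn_of_card_le (h v)
  refine ⟨fun i => c (a i) i, fun i hi => hcZ (a i) i (by simpa using hi), ?_⟩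
  intro i hi j hj hij ha
  exact hc (a i) (by simpa using hi) (by simpa [ha] using hj) (by simpa [ha] using hij)

/-- A word of length `k` with product `1` whose letters at the positions in `s` are distinct terms
of the sequence `a` different from `g`, all other letters being `g`, can be modified so as to use
more terms of `a`, if at least `Fintype.card G` terms other than `g` are unused and none of
their values occurs more often than `g` occurs in the word. -/
theorem exists_ssuperset_prod_ofFn_eq_one {G ι : Type*} [Group G] [Fintype G] [DecidableEq G]
    [Fintype ι] [DecidableEq ι] {k : ℕ} (a : ι → G) (g : G) (s : Finset (Fin k)) (τ : Fin k → ι)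
    (hτ : Set.InjOn τ s)
    (hτg : ∀ p ∈ s, a (τ p) ≠ g)
    (hprod : (List.ofFn fun p => if p ∈ s then a (τ p) else g).prod = 1)
    (hcard : Fintype.card G + #s ≤ #{i | a i ≠ g})
    (hfiber : ∀ v, #{i | a i = v} ≤ #sᶜ) :
    ∃ (t : Finset (Fin k)) (τ' : Fin k → ι), s ⊂ t ∧ Set.InjOn τ' t ∧
      (∀ p ∈ t, a (τ' p) ≠ g) ∧
      (List.ofFn fun p => if p ∈ t then a (τ' p) else g).prod = 1 := by
  let R : Finset ι := ({i | a i ≠ g} : Finset ι) \ s.image τ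
  set x : Fin k → G := fun p => if p ∈ s then a (τ p) else g with hx
  have hRcard : Fintype.card G ≤ #R := by
    have h₁ : _ ≤ #R := le_card_sdiff (s.image τ) ({i | a i ≠ g} : Finset ι)
    have h₂ := card_image_le (s := s) (f := τ)
    omega
  have hRpos : 0 < #R := Fintype.card_pos.trans_le hRcard
  obtain ⟨i₀, hi₀⟩ := card_pos.1 hRpos
  obtain ⟨p₀, -⟩ := card_pos.1 ((card_pos.2 ⟨i₀, by simp⟩).trans_le (hfiber (a i₀)))
  have : Nonempty (Fin k) := ⟨p₀⟩
  obtain ⟨c, hcs, hc⟩ := exists_coloring_of_card_fiber_le R sᶜ a fun v =>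
    (card_le_card (filter_subset_filter _ (subset_univ R))).trans (hfiber v)
  have hRg {i} (hi : i ∈ R) : a i ≠ g := by
    simpa using (mem_sdiff.1 hi).1
  let B (p : Fin k) : Finset G := insert (x p) (image a {i ∈ R | c i = p})
  have hBcard (p) : #(B p) - 1 = #{i ∈ R | c i = p} := by
    rw [card_insert_of_notMem, Nat.add_sub_cancel, card_image_of_injOn]
    · intro i hi j hj hij
      simp only [coe_filter, Set.mem_ofPred_eq] at hi hj
      exact hc i hi.1 j hj.1 (hi.2.trans hj.2.symm) hij
    · simp only [mem_image, mem_filter, not_exists, not_and, and_imp]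
      rintro i hi rfl
      have : c i ∉ s := by simpa using hcs i hi
      simpa [hx, this] using hRg hi
  have hsum : ∑ p, (#(B p) - 1) = #R := by
    simp_rw [hBcard]
    exact (card_eq_sum_card_fiberwise fun i _ => mem_univ (c i)).symm
  obtain ⟨y, hyB, hyx, hne⟩ : ∃ y : Fin k → G, (∀ p, y p ∈ B p) ∧
      (List.ofFn y).prod = (List.ofFn x).prod ∧ y ≠ x := by
    by_contra! H
    have h₁ := sum_card_sub_one_lt_card_prod_ofFn x B (fun p => mem_insert_self _ _) H
    have h₂ := card_le_univ (List.ofFn B).prod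
    omega
  have hy (p) : ∃ i, y p ≠ x p → i ∈ R ∧ c i = p ∧ a i = y p := by
    rcases mem_insert.1 (hyB p) with h | h
    · exact ⟨i₀, fun H => absurd h H⟩
    · obtain ⟨i, hi, hip⟩ := mem_image.1 h
      exact ⟨i, fun _ => ⟨(mem_filter.1 hi).1, (mem_filter.1 hi).2, hip⟩⟩
  choose d hd using hy
  have hys {p} (hp : p ∈ s) : y p = x p := by
    by_contra H
    obtain ⟨h₁, h₂, -⟩ := hd p H
    have := hcs _ h₁
    rw [h₂] at this
    exact mem_compl.1 this hp
  have hdτ {p q} (hp : y p ≠ x p) (hq : q ∈ s) : d p ≠ τ q := fun H =>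
    (mem_sdiff.1 (hd p hp).1).2 (H ▸ mem_image_of_mem τ hq)
  refine ⟨s ∪ ({p | y p ≠ x p} : Finset _), fun p => if p ∈ s then τ p else d p, ?_, ?_, ?_, ?_⟩
  · obtain ⟨p, hp⟩ := Function.ne_iff.1 hne
    exact ssubset_iff_of_subset subset_union_left |>.2
      ⟨p, by simp [hp], fun H => hp (hys H)⟩
  · intro p hp q hq hpq
    simp only [coe_union, coe_filter, mem_univ, true_and, Set.mem_union, mem_coe,
      Set.mem_ofPred_eq] at hp hq
    by_cases hps : p ∈ s <;> by_cases hqs : q ∈ s <;> simp only [hps, hqs, if_true, if_false,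
      true_or, false_or] at hp hq hpq
    · exact hτ hps hqs hpq
    · exact absurd hpq.symm (hdτ hq hps)
    · exact absurd hpq (hdτ hp hqs)
    · rw [← (hd p hp).2.1, hpq, (hd q hq).2.1]
  · intro p hp
    by_cases hps : p ∈ s
    · simpa [hps] using hτg p hps
    · simpa [hps] using hRg (hd p (by simpa [hps] using hp)).1
  · rw [← hprod, ← hyx]
    congr 2
    ext p
    by_cases hps : p ∈ s
    · simp [hps, hys hps, hx]
    by_cases hp : y p = x p
    · simp [hps, hp, hx]
    · simp [hps, hp, (hd p hp).2.2]

/-- Olson's generalization of the Erdős–Ginzburg–Ziv theorem: for any group `G`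
of order `n ≥ 2` and any sequence of `2n-1` elements of `G`, there are `n`
distinct indices whose ordered product is the identity. -/
theorem olson_egz (n : ℕ) (hn : 2 ≤ n) (G : Type*) [Group G] [Fintype G]
    (hG : Fintype.card G = n) (a : Fin (2 * n - 1) → G) :
    ∃ σ : Fin n → Fin (2 * n - 1), Function.Injective σ ∧
      (List.ofFn (fun j : Fin n => a (σ j))).prod = 1 := by
  classical
  obtain ⟨g, -, hg⟩ := exists_max_image univ (fun v : G => #{i | a i = v}) univ_nonempty
  have hcount : #{i | a i = g} + #{i | a i ≠ g} = 2 * n - 1 := by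
    simpa using card_filter_add_card_filter_not (s := univ) (fun i => a i = g)
  let P (s : Finset (Fin n)) : Prop := ∃ τ : Fin n → Fin (2 * n - 1), Set.InjOn τ s ∧
    (∀ p ∈ s, a (τ p) ≠ g) ∧ (List.ofFn fun p => if p ∈ s then a (τ p) else g).prod = 1
  have hP : P ∅ := ⟨fun p => ⟨p, by omega⟩, by simp, by simp, by simp [← hG]⟩
  obtain ⟨s, ⟨τ, hτ, hτg, hprod⟩, hmax⟩ := (Set.toFinite {s | P s}).exists_maximal ⟨∅, hP⟩
  have hs : #sᶜ ≤ #{i | a i = g} := by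
    by_contra! hlt
    have hsc := card_compl_add_card s
    rw [Fintype.card_fin] at hsc
    obtain ⟨t, τ', hst, ht⟩ := exists_ssuperset_prod_ofFn_eq_one a g s τ hτ hτg hprod (by omega)
      fun v => (hg v (mem_univ v)).trans hlt.le
    exact hst.2 (hmax ⟨τ', ht⟩ hst.1)
  have : Nonempty (Fin (2 * n - 1)) := ⟨⟨0, by omega⟩⟩
  obtain ⟨e, hes, he⟩ := exists_injOn_of_card_le hs
  have heg {p} (hp : p ∉ s) : a (e p) = g := by
    simpa using hes p (by simpa using hp)
  refine ⟨fun p => if p ∈ s then τ p else e p, fun p q hpq => ?_, ?_⟩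
  · by_cases hp : p ∈ s <;> by_cases hq : q ∈ s <;>
      simp only [hp, hq, if_true, if_false] at hpq
    · exact hτ hp hq hpq
    · exact absurd (hpq ▸ heg hq) (hτg p hp)
    · exact absurd (hpq ▸ heg hp) (hτg q hq)
    · exact he (by simpa using hp) (by simpa using hq) hpq
  · rw [← hprod]
    congr 2
    ext p
    by_cases hp : p ∈ s
    · simp [hp]
    · simp [hp, heg hp]
end

section
/- Let n ≥ 2 and k ≥ 1 be integers and let m be an integer with m ≥ n(k+1) − 1. Then for every coloring c of the k-element subsets of [m] = {1, …, m} by elements of ℤ/n, there exist n pairwise disjoint k-element subsets A_1, …, A_n ⊆ [m] such that c(A_1) + c(A_2) + ⋯ + c(A_n) = 0 in ℤ/n. -/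
section Packings

variable {α β : Type*} [DecidableEq α]

/-- `X` contains `t` pairwise disjoint subsets satisfying `P`. -/
def HasPacking (P : Finset α → Prop) : ℕ → Finset α → Prop
  | 0, _ => True
  | t + 1, X => ∃ S ⊆ X, P S ∧ HasPacking P t (X \ S)

/-- `X` contains `t` pairwise disjoint `k`-subsets whose colors under `c` sum to `s`. -/
def HasMatchingSum (c : Finset α → ℤ) (k : ℕ) : ℕ → Finset α → ℤ → Prop
  | 0, _, s => s = 0
  | t + 1, X, s => ∃ A ⊆ X, A.card = k ∧ HasMatchingSum c k t (X \ A) (s - c A)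

/-- `S` is a `(k + 1)`-set whose `k`-subsets do not all have the same color. -/
def IsBichromatic (d : Finset α → β) (k : ℕ) (S : Finset α) : Prop :=
  S.card = k + 1 ∧ ∃ A ⊆ S, ∃ B ⊆ S, A.card = k ∧ B.card = k ∧ d A ≠ d B

theorem HasPacking.mono {P : Finset α → Prop} {t : ℕ} {X Y : Finset α}
    (h : HasPacking P t X) (hXY : X ⊆ Y) : HasPacking P t Y := by
  induction t generalizing X Y with
  | zero => trivial
  | succ t ih =>
    obtain ⟨S, hS, hP, h⟩ := h
    exact ⟨S, hS.trans hXY, hP, ih h (Finset.sdiff_subset_sdiff hXY le_rfl)⟩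

theorem HasPacking.cons {P : Finset α → Prop} {t : ℕ} {X Y S : Finset α}
    (h : HasPacking P t Y) (hS : P S) (hSX : S ⊆ X) (hYX : Y ⊆ X) (hd : Disjoint Y S) :
    HasPacking P (t + 1) X :=
  ⟨S, hSX, hS, h.mono (Finset.subset_sdiff.2 ⟨hYX, hd⟩)⟩

/-- A packing by sets of size `l` is supported on a set of size `t * l`. -/
theorem HasPacking.exists_support {P : Finset α → Prop} {l t : ℕ} {X : Finset α}
    (hP : ∀ S, P S → S.card = l) (h : HasPacking P t X) :
    ∃ Y ⊆ X, Y.card = t * l ∧ HasPacking P t Y := by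
  induction t generalizing X with
  | zero => exact ⟨∅, by simp, by simp, trivial⟩
  | succ t ih =>
    obtain ⟨S, hS, hPS, h⟩ := h
    obtain ⟨Y, hY, hYc, hYp⟩ := ih h
    have hd : Disjoint Y S := (Finset.subset_sdiff.1 hY).2
    refine ⟨Y ∪ S, Finset.union_subset (hY.trans Finset.sdiff_subset) hS, ?_,
      hYp.cons hPS Finset.subset_union_right Finset.subset_union_left hd⟩
    rw [Finset.card_union_of_disjoint hd, hYc, hP S hPS]
    ring

theorem HasMatchingSum.mono {c : Finset α → ℤ} {k t : ℕ} {X Y : Finset α} {s : ℤ}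
    (h : HasMatchingSum c k t X s) (hXY : X ⊆ Y) : HasMatchingSum c k t Y s := by
  induction t generalizing X Y s with
  | zero => exact h
  | succ t ih =>
    obtain ⟨A, hA, hc, h⟩ := h
    exact ⟨A, hA.trans hXY, hc, ih h (Finset.sdiff_subset_sdiff hXY le_rfl)⟩

theorem HasMatchingSum.add {c : Finset α → ℤ} {k t u : ℕ} {X Y Z : Finset α} {a b : ℤ}
    (hX : HasMatchingSum c k t X a) (hY : HasMatchingSum c k u Y b) (hd : Disjoint X Y)
    (hXZ : X ⊆ Z) (hYZ : Y ⊆ Z) : HasMatchingSum c k (t + u) Z (a + b) := by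
  induction t generalizing X Z a with
  | zero =>
    obtain rfl : a = 0 := hX
    simpa using hY.mono hYZ
  | succ t ih =>
    obtain ⟨A, hA, hc, h⟩ := hX
    rw [Nat.succ_add]
    refine ⟨A, hA.trans hXZ, hc, ?_⟩
    rw [add_sub_right_comm]
    exact ih h (hd.mono_left Finset.sdiff_subset) (Finset.sdiff_subset_sdiff hXZ le_rfl)
      (Finset.subset_sdiff.2 ⟨hYZ, (hd.mono_left hA).symm⟩)

/-- A matching of large sets, each of which carries a matching of `p` small sets, can be refined. -/
theorem HasMatchingSum.refine {c c' : Finset α → ℤ} {k k' p t : ℕ} {X : Finset α} {s : ℤ}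
    (hc : ∀ B : Finset α, B.card = k' → HasMatchingSum c k p B (p * c' B))
    (h : HasMatchingSum c' k' t X s) : HasMatchingSum c k (p * t) X (p * s) := by
  induction t generalizing X s with
  | zero =>
    obtain rfl : s = 0 := h
    simp [HasMatchingSum]
  | succ t ih =>
    obtain ⟨B, hB, hBc, h⟩ := h
    have := (ih h).add (hc B hBc) Finset.sdiff_disjoint Finset.sdiff_subset hB
    rwa [← mul_add, sub_add_cancel] at this

theorem HasMatchingSum.exists_fin {c : Finset α → ℤ} {k t : ℕ} {X : Finset α} {s : ℤ}
    (h : HasMatchingSum c k t X s) :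
    ∃ A : Fin t → Finset α, (∀ i, A i ⊆ X) ∧ (∀ i, (A i).card = k) ∧
      (∀ i j, i ≠ j → Disjoint (A i) (A j)) ∧ ∑ i, c (A i) = s := by
  induction t generalizing X s with
  | zero =>
    obtain rfl : s = 0 := h
    exact ⟨fun _ => ∅, by simp, fun i => i.elim0, by simp, by simp⟩
  | succ t ih =>
    obtain ⟨B, hB, hBc, h⟩ := h
    obtain ⟨A, hA, hAc, hAd, hs⟩ := ih h
    have hd (i) : Disjoint (A i) B := (Finset.subset_sdiff.1 (hA i)).2
    refine ⟨Fin.cons B A, ?_, ?_, ?_, ?_⟩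
    · exact Fin.cases hB fun i => (hA i).trans Finset.sdiff_subset
    · exact Fin.cases hBc hAc
    · intro i j
      cases i using Fin.cases <;> cases j using Fin.cases
      · simp
      · exact fun _ => (hd _).symm
      · exact fun _ => hd _
      · simpa using hAd _ _
    · simp [Fin.sum_univ_succ, hs]

/-- Exchanging elements one at a time between two `k`-sets of different colors meets a
`(k + 1)`-set with a `k`-subset of the final color and one of another color. -/
theorem exists_exchange {d : Finset α → β} {k : ℕ} {A B : Finset α} (hA : A.card = k)
    (hB : B.card = k) (hAB : d A ≠ d B) :
    ∃ S ⊆ A ∪ B, S.card = k + 1 ∧ (∃ B' ⊆ S, B'.card = k ∧ d B' = d B) ∧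
      ∃ A' ⊆ S, A'.card = k ∧ d A' ≠ d B := by
  induction h : (A \ B).card generalizing A with
  | zero =>
    rw [Finset.card_eq_zero, Finset.sdiff_eq_empty_iff_subset] at h
    exact absurd (congrArg d (Finset.eq_of_subset_of_card_le h (by omega))) hAB
  | succ j ih =>
    obtain ⟨a, ha⟩ : (A \ B).Nonempty := Finset.card_pos.1 (by omega)
    have hBA : (B \ A).card = (A \ B).card := Finset.card_sdiff_comm (hB.trans hA.symm)
    obtain ⟨b, hb⟩ : (B \ A).Nonempty := Finset.card_pos.1 (by omega)
    rw [Finset.mem_sdiff] at ha hb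
    have hC : (insert b (A.erase a)).card = k := by
      have := Finset.card_pos.2 ⟨a, ha.1⟩
      rw [Finset.card_insert_of_notMem (by simp [hb.2]), Finset.card_erase_of_mem ha.1]
      omega
    by_cases hd : d (insert b (A.erase a)) = d B
    · refine ⟨insert b A, by grind, by rw [Finset.card_insert_of_notMem hb.2, hA],
        ⟨_, by grind, hC, hd⟩, ⟨A, by grind, hA, hAB⟩⟩
    · have hsd : insert b (A.erase a) \ B = (A \ B).erase a := by
        rw [Finset.insert_sdiff_of_mem _ hb.1, Finset.erase_sdiff_comm]
      obtain ⟨S, hS, hS'⟩ := ih hC hd (by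
        rw [hsd, Finset.card_erase_of_mem (Finset.mem_sdiff.2 ha)]; omega)
      exact ⟨S, by grind, hS'⟩

theorem exists_isBichromatic {d : Finset α → β} {k : ℕ} {A B : Finset α} (hA : A.card = k)
    (hB : B.card = k) (hAB : d A ≠ d B) : ∃ S ⊆ A ∪ B, IsBichromatic d k S := by
  obtain ⟨S, hS, hSc, ⟨B', hB', hBc, hBd⟩, A', hA', hAc, hAd⟩ := exists_exchange hA hB hAB
  exact ⟨S, hS, hSc, A', hA', B', hB', hAc, hBc, by rwa [hBd]⟩

theorem hasPacking_of_monochromatic {d : Finset α → β} {k r : ℕ} {z : β} {R : Finset α}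
    (hR : ∀ A ⊆ R, A.card = k → d A = z) (hr : r * k ≤ R.card) :
    HasPacking (fun A => A.card = k ∧ d A = z) r R := by
  induction r generalizing R with
  | zero => trivial
  | succ r ih =>
    rw [Nat.succ_mul] at hr
    obtain ⟨A, hA, hAc⟩ := Finset.exists_subset_card_eq (show k ≤ R.card by omega)
    refine ⟨A, hA, ⟨hAc, hR A hA hAc⟩, ih (fun B hB => hR B (hB.trans Finset.sdiff_subset)) ?_⟩
    rw [Finset.card_sdiff_of_subset hA]
    omega

/-- If `t` is the largest size of a packing by bichromatic sets and the complement `R` of such a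
packing is large and of color `z`, then every set of the packing can be exchanged for one that has a
`k`-subset of color `z`. -/
theorem hasPacking_of_maximal {d : Finset α → β} {k r t : ℕ} {z : β} {R X : Finset α}
    (hRX : Disjoint R X) (hR : ∀ A ⊆ R, A.card = k → d A = z) (hr : 2 ≤ r)
    (hRr : r * (k + 1) ≤ R.card + 1) (hX : HasPacking (IsBichromatic d k) t X)
    (hmax : ¬ HasPacking (IsBichromatic d k) (t + 1) (R ∪ X)) :
    HasPacking (fun A => A.card = k ∧ d A = z) (t + r) (R ∪ X) := by
  have hR2 : 2 * (k + 1) ≤ R.card + 1 := (Nat.mul_le_mul_right _ hr).trans hRr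
  induction t generalizing R X with
  | zero =>
    rw [Nat.zero_add]
    refine (hasPacking_of_monochromatic hR ?_).mono Finset.subset_union_left
    rw [Nat.mul_succ] at hRr
    omega
  | succ t ih =>
    obtain ⟨S, hSX, ⟨hSc, A₁, hA₁, A₂, hA₂, hA₁c, hA₂c, hne⟩, hX'⟩ := hX
    obtain ⟨A, hAS, hAc, hAz⟩ : ∃ A ⊆ S, A.card = k ∧ d A ≠ z := by
      by_cases h : d A₁ = z
      · exact ⟨A₂, hA₂, hA₂c, fun h' => hne (h.trans h'.symm)⟩
      · exact ⟨A₁, hA₁, hA₁c, h⟩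
    obtain ⟨B, hBR, hBc⟩ := Finset.exists_subset_card_eq (show k ≤ R.card by omega)
    have hBz := hR B hBR hBc
    obtain ⟨T, hT, hTc, ⟨B', hB', hB'c, hB'd⟩, A', hA', hA'c, hA'd⟩ :=
      exists_exchange (d := d) hAc hBc (by rwa [hBz])
    rw [hBz] at hB'd hA'd
    have hTb : IsBichromatic d k T :=
      ⟨hTc, A', hA', B', hB', hA'c, hB'c, by rwa [hB'd]⟩
    have hTSR : T ⊆ S ∪ R := hT.trans (Finset.union_subset_union hAS hBR)
    have hSR : Disjoint S R := (hRX.mono_right hSX).symm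
    set R' := (S ∪ R) \ T with hR'
    have hR'c : R'.card = R.card := by
      rw [hR', Finset.card_sdiff_of_subset hTSR, Finset.card_union_of_disjoint hSR]
      omega
    have hR'X : Disjoint R' (X \ S) := by
      rw [Finset.disjoint_left] at hRX ⊢
      grind
    have hTX : Disjoint (R' ∪ X \ S) T := by
      rw [Finset.disjoint_left] at hRX ⊢
      grind
    have hsub : R' ∪ X \ S ⊆ R ∪ X := by grind
    have hTsub : T ⊆ R ∪ X := by grind
    have hmax' : ¬ HasPacking (IsBichromatic d k) (t + 1) (R' ∪ X \ S) := fun h =>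
      hmax (h.cons hTb hTsub hsub hTX)
    have hTR : (R ∩ T).card ≤ k := by
      have : R ∩ T ⊂ T := Finset.inter_subset_right.ssubset_of_ne fun h =>
        hA'd (hR A' (hA'.trans (Finset.inter_eq_right.1 h)) hA'c)
      have := Finset.card_lt_card this
      omega
    obtain ⟨C, hC, hCc⟩ := Finset.exists_subset_card_eq (show k ≤ (R \ T).card by
      have := Finset.card_inter_add_card_sdiff R T
      omega)
    have hCz := hR C (hC.trans Finset.sdiff_subset) hCc
    have hR'z : ∀ D ⊆ R', D.card = k → d D = z := by
      intro D hD hDc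
      by_contra hDz
      obtain ⟨U, hU, hUb⟩ := exists_isBichromatic (d := d) hDc hCc (by rwa [hCz])
      have hUR : U ⊆ R' := hU.trans (Finset.union_subset hD
        (hC.trans (Finset.sdiff_subset_sdiff Finset.subset_union_right le_rfl)))
      exact hmax' (hX'.cons hUb (hUR.trans Finset.subset_union_left) Finset.subset_union_right
        (hR'X.symm.mono_right hUR))
    have := ih hR'X hR'z (by rwa [hR'c]) hX' hmax' (by rwa [hR'c])
    rw [Nat.succ_add]
    exact this.cons ⟨hB'c, hB'd⟩ (hB'.trans hTsub) hsub (hTX.mono_right hB')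

/-- A large set has `p - 1` disjoint bichromatic subsets or `p` disjoint `k`-subsets of the same
color. -/
theorem hasPacking_isBichromatic_or_monochromatic (d : Finset α → β) {k p : ℕ} (hp : 2 ≤ p)
    {X : Finset α} (hX : p * (k + 1) ≤ X.card + 1) :
    HasPacking (IsBichromatic d k) (p - 1) X ∨
      ∃ z, HasPacking (fun A => A.card = k ∧ d A = z) p X := by
  classical
  refine or_iff_not_imp_left.2 fun hbi => ?_
  have hex : ∃ t, ¬ HasPacking (IsBichromatic d k) (t + 1) X :=
    ⟨p - 2, by rwa [show p - 2 + 1 = p - 1 by omega]⟩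
  obtain ⟨t, ht, htmax, htp⟩ : ∃ t, HasPacking (IsBichromatic d k) t X ∧
      ¬ HasPacking (IsBichromatic d k) (t + 1) X ∧ t + 2 ≤ p := by
    refine ⟨Nat.find hex, ?_, Nat.find_spec hex, ?_⟩
    · rcases h : Nat.find hex with _ | t
      · trivial
      · exact not_not.1 (Nat.find_min hex (m := t) (by omega))
    · have := Nat.find_min' hex (m := p - 2) (by rwa [show p - 2 + 1 = p - 1 by omega])
      omega
  obtain ⟨Y, hYX, hYc, hY⟩ := ht.exists_support fun S hS => hS.1
  obtain ⟨r, rfl⟩ := Nat.exists_eq_add_of_le (show t ≤ p by omega)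
  have hRc : r * (k + 1) ≤ (X \ Y).card + 1 := by
    rw [Finset.card_sdiff_of_subset hYX, hYc]
    rw [add_mul] at hX
    omega
  have hr : 2 ≤ r := by omega
  obtain ⟨B, hB, hBc⟩ := Finset.exists_subset_card_eq (show k ≤ (X \ Y).card by
    have := (Nat.mul_le_mul_right (k + 1) hr).trans hRc
    omega)
  have hXY : X \ Y ∪ Y = X := Finset.sdiff_union_of_subset hYX
  refine ⟨d B, ?_⟩
  have := hasPacking_of_maximal (d := d) (z := d B) (Finset.sdiff_disjoint (s := Y) (t := X))
    ?_ hr hRc hY (by rwa [hXY])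
  · rwa [hXY] at this
  · intro A hA hAc
    by_contra hAB
    obtain ⟨S, hS, hSb⟩ := exists_isBichromatic hAc hBc hAB
    have hSXY := hS.trans (Finset.union_subset hA hB)
    exact htmax (hY.cons hSb (hSXY.trans Finset.sdiff_subset) hYX
      (Finset.sdiff_disjoint.symm.mono_right hSXY))

open scoped Pointwise in
/-- By the Cauchy–Davenport theorem, `t` disjoint bichromatic sets carry matchings with at least
`t + 1` different sums modulo `p`. -/
theorem HasPacking.exists_sums {p : ℕ} [Fact p.Prime] {c : Finset α → ℤ} {k t : ℕ} {X : Finset α}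
    (h : HasPacking (IsBichromatic (fun A => (c A : ZMod p)) k) t X) :
    ∃ T : Finset (ZMod p), min p (t + 1) ≤ T.card ∧
      ∀ x ∈ T, ∃ s : ℤ, HasMatchingSum c k t X s ∧ (s : ZMod p) = x := by
  induction t generalizing X with
  | zero => exact ⟨{0}, by simp, fun x hx => ⟨0, rfl, by simp_all⟩⟩
  | succ t ih =>
    obtain ⟨S, hSX, ⟨hSc, A, hA, B, hB, hAc, hBc, hne⟩, h⟩ := h
    obtain ⟨T, hTc, hT⟩ := ih h
    refine ⟨{(c A : ZMod p), (c B : ZMod p)} + T, ?_, ?_⟩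
    · have hT0 : T.Nonempty := by
        have := (Fact.out : p.Prime).pos
        exact Finset.card_pos.1 (by omega)
      have := ZMod.cauchy_davenport (Fact.out : p.Prime)
        (Finset.insert_nonempty (c A : ZMod p) {(c B : ZMod p)}) hT0
      rw [Finset.card_pair hne] at this
      omega
    · have key (D : Finset α) (hD : D ⊆ S) (hDc : D.card = k) (y : ZMod p) (hy : y ∈ T) :
          ∃ s : ℤ, HasMatchingSum c k (t + 1) X s ∧ (s : ZMod p) = c D + y := by
        obtain ⟨s, hs, rfl⟩ := hT y hy
        refine ⟨c D + s, ⟨D, hD.trans hSX, hDc, ?_⟩, by push_cast; rfl⟩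
        rw [add_sub_cancel_left]
        exact hs.mono (Finset.sdiff_subset_sdiff le_rfl hD)
      intro x hx
      obtain ⟨u, hu, y, hy, rfl⟩ := Finset.mem_add.1 hx
      rcases Finset.mem_insert.1 hu with rfl | hu
      · exact key A hA hAc y hy
      · rw [Finset.mem_singleton.1 hu]
        exact key B hB hBc y hy

theorem HasPacking.exists_sum {p : ℕ} {c : Finset α → ℤ} {k t : ℕ} {X : Finset α} {z : ZMod p}
    (h : HasPacking (fun A => A.card = k ∧ (c A : ZMod p) = z) t X) :
    ∃ s : ℤ, HasMatchingSum c k t X s ∧ (s : ZMod p) = t * z := by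
  induction t generalizing X with
  | zero => exact ⟨0, rfl, by simp⟩
  | succ t ih =>
    obtain ⟨A, hA, ⟨hAc, rfl⟩, h⟩ := h
    obtain ⟨s, hs, hsz⟩ := ih h
    exact ⟨s + c A, ⟨A, hA, hAc, by rwa [add_sub_cancel_right]⟩, by push_cast; rw [hsz]; ring⟩

theorem exists_hasMatchingSum_prime {p : ℕ} (hp : p.Prime) (c : Finset α → ℤ) {k : ℕ}
    {X : Finset α} (hX : p * (k + 1) ≤ X.card + 1) :
    ∃ s : ℤ, HasMatchingSum c k p X s ∧ (p : ℤ) ∣ s := by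
  have : Fact p.Prime := ⟨hp⟩
  simp_rw [← ZMod.intCast_zmod_eq_zero_iff_dvd]
  rcases hasPacking_isBichromatic_or_monochromatic (fun A => (c A : ZMod p)) hp.two_le hX with
    h | ⟨z, h⟩
  · obtain ⟨Y, hYX, hYc, hY⟩ := h.exists_support fun S hS => hS.1
    obtain ⟨T, hTc, hT⟩ := hY.exists_sums
    have hp1 : p - 1 + 1 = p := Nat.sub_add_cancel hp.one_le
    have hTu : T = Finset.univ := by
      rw [← Finset.card_eq_iff_eq_univ, ZMod.card]
      have := T.card_le_univ
      rw [ZMod.card] at this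
      omega
    obtain ⟨A, hA, hAc⟩ := Finset.exists_subset_card_eq (show k ≤ (X \ Y).card by
      rw [Finset.card_sdiff_of_subset hYX, hYc]
      rw [← hp1, add_mul] at hX
      omega)
    obtain ⟨s, hs, hsA⟩ := hT (-(c A : ZMod p)) (hTu ▸ Finset.mem_univ _)
    have hAY := Finset.subset_sdiff.1 hA
    refine ⟨s + c A, ?_, by push_cast; rw [hsA]; ring⟩
    have : HasMatchingSum c k (p - 1 + 1) X (s + c A) :=
      ⟨A, hAY.1, hAc, by
        rw [add_sub_cancel_right]
        exact hs.mono (Finset.subset_sdiff.2 ⟨hYX, hAY.2.symm⟩)⟩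
    rwa [hp1] at this
  · obtain ⟨s, hs, hsz⟩ := h.exists_sum
    exact ⟨s, hs, by simp [hsz]⟩

theorem exists_hasMatchingSum {n : ℕ} (hn : n ≠ 0) (c : Finset α → ℤ) {k : ℕ}
    {X : Finset α} (hX : n * (k + 1) ≤ X.card + 1) :
    ∃ s : ℤ, HasMatchingSum c k n X s ∧ (n : ℤ) ∣ s := by
  induction n using induction_on_primes generalizing c k with
  | zero => exact absurd rfl hn
  | one =>
    obtain ⟨A, hA, hAc⟩ := Finset.exists_subset_card_eq (show k ≤ X.card by omega)
    exact ⟨c A, ⟨A, hA, hAc, sub_self _⟩, by simp⟩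
  | prime_mul p a hp ih =>
    have hpk : p * (k + 1) - 1 + 1 = p * (k + 1) :=
      Nat.sub_add_cancel (Nat.mul_pos hp.pos k.succ_pos)
    have key (B : Finset α) : ∃ s : ℤ,
        B.card = p * (k + 1) - 1 → HasMatchingSum c k p B (p * s) := by
      by_cases hB : B.card = p * (k + 1) - 1
      · obtain ⟨_, hs, s, rfl⟩ := exists_hasMatchingSum_prime hp c (k := k) (X := B) (by omega)
        exact ⟨s, fun _ => hs⟩
      · exact ⟨0, fun h => absurd h hB⟩
    choose c' hc' using key
    obtain ⟨s, hs, hdvd⟩ := ih (right_ne_zero_of_mul hn) c' (k := p * (k + 1) - 1) (by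
      rw [hpk]
      linarith)
    exact ⟨p * s, hs.refine hc', by push_cast; exact mul_dvd_mul_left _ hdvd⟩

end Packings

/-- Zero-sum matchings: for `n ≥ 2`, `k ≥ 1` and `m ≥ n(k+1) - 1`, every
`ℤ/n`-coloring of the `k`-element subsets of `[m]` admits `n` pairwise disjoint
`k`-element subsets whose colors sum to zero. -/
theorem zero_sum_matching (n k m : ℕ) (hn : 2 ≤ n) (hk : 1 ≤ k)
    (hm : n * (k + 1) ≤ m + 1) (c : Finset (Fin m) → ZMod n) :
    ∃ A : Fin n → Finset (Fin m), (∀ i, (A i).card = k) ∧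
      (∀ i j, i ≠ j → Disjoint (A i) (A j)) ∧
      ∑ i, c (A i) = 0 := by
  obtain ⟨s, hs, hdvd⟩ := exists_hasMatchingSum (n := n) (by omega)
    (fun A : Finset (Fin m) => ((c A).cast : ℤ)) (k := k) (X := Finset.univ) (by simpa using hm)
  obtain ⟨A, -, hAc, hAd, rfl⟩ := hs.exists_fin
  refine ⟨A, hAc, hAd, ?_⟩
  rw [← ZMod.intCast_zmod_eq_zero_iff_dvd] at hdvd
  simpa using hdvd
end

section
/- Let n ≥ 1 be an integer. A sequence a_1, …, a_n of elements of ℤ/n satisfies a_1 + a_2 + ⋯ + a_n = 0 if and only if there exist two bijections b, c : {1, …, n} → ℤ/n (i.e., two orderings b_1, …, b_n and c_1, …, c_n of all elements of ℤ/n) such that a_i = b_i − c_i for every i ∈ {1, …, n}. -/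
/-- A permutation `f`, possibly after exchanging its values at two given distinct points, has an
invariant set that separates these points. -/
theorem Equiv.Perm.exists_separating_invariant {G : Type*} [Finite G] [DecidableEq G]
    (f : Equiv.Perm G) {u v : G} (huv : u ≠ v) :
    ∃ g : Equiv.Perm G, (∀ x, x ≠ u → x ≠ v → g x = f x) ∧
      ∃ p : G → Prop, p v ∧ ¬ p u ∧ ∀ x, p (g x) ↔ p x := by
  by_cases h : f.SameCycle u v
  · have hex : ∃ k : ℕ, 0 < k ∧ (f ^ k) u = v := by
      obtain ⟨k, hk, -, hkv⟩ := h.exists_pow_eq''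
      exact ⟨k, hk, hkv⟩
    classical
    obtain ⟨k, ⟨hk0, hkv⟩, hmin⟩ :
        ∃ k : ℕ, (0 < k ∧ (f ^ k) u = v) ∧ ∀ l < k, 0 < l → (f ^ l) u ≠ v :=
      ⟨Nat.find hex, Nat.find_spec hex, fun l hl h0 h1 => Nat.find_min hex hl ⟨h0, h1⟩⟩
    have hu : ∀ l, 0 < l → l ≤ k → (f ^ l) u ≠ u := by
      intro l hl0 hlk hlu
      obtain rfl | hlt := hlk.eq_or_lt
      · exact huv (hlu.symm.trans hkv)
      · refine hmin (k - l) (by lia) (by lia) ?_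
        conv_lhs => rw [← hlu]
        rw [← Equiv.Perm.mul_apply, ← pow_add, Nat.sub_add_cancel hlk, hkv]
    let p : G → Prop := fun x => ∃ l, 0 < l ∧ l ≤ k ∧ (f ^ l) u = x
    let g := f * Equiv.swap u v
    have hgf : ∀ x, x ≠ u → x ≠ v → g x = f x := fun x hxu hxv => by
      simp [g, Equiv.swap_apply_of_ne_of_ne hxu hxv]
    have hmaps : ∀ x, p x → p (g x) := by
      rintro x ⟨l, hl0, hlk, rfl⟩
      obtain rfl | hlt := hlk.eq_or_lt
      · exact ⟨1, one_pos, hl0, by simp [g, hkv]⟩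
      · refine ⟨l + 1, l.succ_pos, hlt, ?_⟩
        rw [hgf _ (hu l hl0 hlk) (hmin l hlt hl0), pow_succ', Equiv.Perm.mul_apply]
    refine ⟨g, hgf, p, ⟨k, hk0, le_rfl, hkv⟩, fun ⟨l, hl0, hlk, hlu⟩ => hu l hl0 hlk hlu,
      fun x => ⟨fun hx => ?_, hmaps x⟩⟩
    have hiter : ∀ m : ℕ, p ((g ^ m) (g x)) := by
      intro m
      induction m with
      | zero => exact hx
      | succ m ih =>
        rw [pow_succ', Equiv.Perm.mul_apply]
        exact hmaps _ ih
    have hord := hiter (orderOf g - 1)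
    rwa [← Equiv.Perm.mul_apply, ← pow_succ, Nat.sub_add_cancel (orderOf_pos g),
      pow_orderOf_eq_one] at hord
  · exact ⟨f, fun _ _ _ => rfl, fun x => f.SameCycle v x, .refl _ _, fun h' => h h'.symm,
      fun x => Equiv.Perm.sameCycle_apply_right⟩

/-- Two orderings `b`, `c` of a finite set can be modified so that the pair at the index `i` becomes
`(b i, b j)`, while the pairs at indices other than `i` and `j` change at most by a swap. -/
theorem Equiv.exists_pair_rearrangement {ι G : Type*} [Finite G] (b c : ι ≃ G) {i j : ι}
    (hij : i ≠ j) :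
    ∃ b' c' : ι ≃ G, b' i = b i ∧ c' i = b j ∧
      ∀ k, k ≠ i → k ≠ j → s(b' k, c' k) = s(b k, c k) := by
  classical
  obtain ⟨g, hg, p, hpv, hpu, hp⟩ :=
    Equiv.Perm.exists_separating_invariant (b.symm.trans c) (b.injective.ne hij)
  let flip : Equiv.Perm G := Equiv.Perm.ofSubtype (g.subtypePerm hp)
  let coflip : Equiv.Perm G :=
    Equiv.Perm.ofSubtype (g.subtypePerm (p := fun x => ¬ p x) fun x => not_congr (hp x))
  have flip_of_mem : ∀ x, p x → flip x = g x := fun x hx => by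
    simp [flip, Equiv.Perm.ofSubtype_apply_of_mem _ hx]
  have flip_of_not_mem : ∀ x, ¬ p x → flip x = x := fun x hx =>
    Equiv.Perm.ofSubtype_apply_of_not_mem _ hx
  have coflip_of_mem : ∀ x, p x → coflip x = x := fun x hx =>
    Equiv.Perm.ofSubtype_apply_of_not_mem _ (not_not.2 hx)
  have coflip_of_not_mem : ∀ x, ¬ p x → coflip x = g x := fun x hx => by
    simp only [coflip]
    rw [Equiv.Perm.ofSubtype_apply_of_mem (p := fun x => ¬ p x) _ hx]
    rfl
  refine ⟨b.trans flip, ((Equiv.swap i j).trans b).trans coflip, flip_of_not_mem _ hpu,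
    by simp [coflip_of_mem _ hpv], fun k hki hkj => ?_⟩
  have hgk : g (b k) = c k := by
    simp [hg (b k) (b.injective.ne hki) (b.injective.ne hkj)]
  by_cases hk : p (b k)
  · simp [Equiv.swap_apply_of_ne_of_ne hki hkj, flip_of_mem _ hk, coflip_of_mem _ hk, hgk]
  · simp [Equiv.swap_apply_of_ne_of_ne hki hkj, flip_of_not_mem _ hk, coflip_of_not_mem _ hk, hgk]

/-- The termwise sum of two orderings of a finite abelian group can be prescribed at one index `i`
at the expense of a second index `j`. -/
theorem Equiv.exists_add_prescribed_at {ι G : Type*} [Finite G] [AddCommGroup G] (b c : ι ≃ G)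
    {i j : ι} (hij : i ≠ j) (t : G) :
    ∃ b' c' : ι ≃ G, b' i + c' i = t ∧ ∀ k, k ≠ i → k ≠ j → b' k + c' k = b k + c k := by
  let s := b i + b j - t
  obtain ⟨b', c', hbi, hci, h⟩ :=
    b.exists_pair_rearrangement (c.trans (Equiv.addRight s)) hij
  refine ⟨b', c'.trans (Equiv.subRight s), ?_, fun k hki hkj => ?_⟩
  · simp [hbi, hci, s, ← add_sub_assoc]
  · have hk : b' k + c' k = b k + (c k + s) := by
      simpa using congrArg (Sym2.lift ⟨(· + ·), add_comm⟩) (h k hki hkj)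
    simp [← add_sub_assoc, hk, ← add_assoc]

/-- The termwise sum of two orderings of a finite abelian group can be prescribed on any finite set
of indices that omits some index. -/
theorem Equiv.exists_add_prescribed_on {ι G : Type*} [Finite G] [AddCommGroup G] (e : ι ≃ G)
    (a : ι → G) (j : ι) (s : Finset ι) (hj : j ∉ s) :
    ∃ b c : ι ≃ G, ∀ k ∈ s, b k + c k = a k := by
  classical
  induction s using Finset.induction_on with
  | empty => exact ⟨e, e, by simp⟩
  | insert i s hi ih =>
    rw [Finset.mem_insert, not_or] at hj
    obtain ⟨b, c, hbc⟩ := ih hj.2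
    obtain ⟨b', c', h, h'⟩ := b.exists_add_prescribed_at c (Ne.symm hj.1) (a i)
    refine ⟨b', c', fun k hk => ?_⟩
    obtain rfl | hk := Finset.mem_insert.1 hk
    · exact h
    · rw [h' k (ne_of_mem_of_not_mem hk hi) (ne_of_mem_of_not_mem hk hj.2), hbc k hk]

/-- A family indexed by a set with as many elements as a finite abelian group sums to zero if and
only if it is the termwise difference of two orderings of the group. -/
theorem sum_eq_zero_iff_exists_equiv_sub {ι G : Type*} [Fintype ι] [AddCommGroup G]
    (e : ι ≃ G) (a : ι → G) :
    ∑ i, a i = 0 ↔ ∃ b c : ι ≃ G, ∀ i, a i = b i - c i := by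
  classical
  have hsum : ∀ b c : ι ≃ G, ∑ i, (b i - c i) = 0 := fun b c => by
    rw [Finset.sum_sub_distrib, sub_eq_zero, ← Equiv.sum_comp (b.trans c.symm) c]
    simp
  refine ⟨fun ha => ?_, fun ⟨b, c, h⟩ => by simp only [h, hsum]⟩
  have : Finite G := .of_equiv ι e
  let j := e.symm 0
  obtain ⟨b, c, hbc⟩ :=
    e.exists_add_prescribed_on a j (Finset.univ.erase j) (Finset.notMem_erase _ _)
  let c' := c.trans (Equiv.neg G)
  have h : ∀ k, k ≠ j → a k = b k - c' k := fun k hk => by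
    simp [c', hbc k (Finset.mem_erase.2 ⟨hk, Finset.mem_univ k⟩)]
  refine ⟨b, c', fun k => ?_⟩
  obtain rfl | hk := eq_or_ne k j
  · have hrest : ∑ k ∈ Finset.univ.erase j, a k = ∑ k ∈ Finset.univ.erase j, (b k - c' k) :=
      Finset.sum_congr rfl fun k hk => h k (Finset.ne_of_mem_erase hk)
    have htotal := ha.trans (hsum b c').symm
    rwa [← Finset.add_sum_erase _ _ (Finset.mem_univ j),
      ← Finset.add_sum_erase _ _ (Finset.mem_univ j), hrest, add_left_inj] at htotal
  · exact h k hk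

/-- Marshall Hall's characterization of zero-sum sequences in `ℤ/n`: a sequence
`a_1, …, a_n` of elements of `ℤ/n` sums to zero if and only if it is the
termwise difference of two orderings of all elements of `ℤ/n`. -/
theorem hall_zero_sum (n : ℕ) (hn : 1 ≤ n) (a : Fin n → ZMod n) :
    (∑ i, a i = 0) ↔
      ∃ b c : Fin n → ZMod n, Function.Bijective b ∧ Function.Bijective c ∧
        ∀ i, a i = b i - c i := by
  have : NeZero n := ⟨by lia⟩
  rw [sum_eq_zero_iff_exists_equiv_sub (ZMod.finEquiv n).toEquiv a]
  constructor
  · rintro ⟨b, c, h⟩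
    exact ⟨b, c, b.bijective, c.bijective, h⟩
  · rintro ⟨b, c, hb, hc, h⟩
    exact ⟨.ofBijective b hb, .ofBijective c hc, h⟩
end

section
/- Let p be a prime and let μ_1, …, μ_{2p−1} be probability measures on ℤ/p, i.e., functions μ_j : ℤ/p → ℝ with μ_j(x) ≥ 0 for all x and Σ_{x ∈ ℤ/p} μ_j(x) = 1. Then there exist an injective map π : ℤ/p → {1, …, 2p−1} and convex coefficients λ_i ≥ 0 for i ∈ ℤ/p with Σ_{i ∈ ℤ/p} λ_i = 1, such that Σ_{i ∈ ℤ/p} λ_i · (μ_{π(i)} + i) is the uniform probability measure on ℤ/p; explicitly, for every x ∈ ℤ/p, Σ_{i ∈ ℤ/p} λ_i · μ_{π(i)}(x − i) = 1/p. -/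
section ConeSign

variable {ι κ V : Type*} [Fintype ι] [DecidableEq ι] [Fintype κ] [AddCommGroup V] [Module ℝ V]

/-- Moving along the line `lam + t • c` until it leaves the nonnegative orthant. -/
lemma exists_nonneg_exit {lam c : κ → ℝ} (hlam : ∀ i, 0 ≤ lam i) (hc : ∃ k, c k < 0) :
    ∃ t : ℝ, ∃ k, c k < 0 ∧ lam k + t * c k = 0 ∧ ∀ i, 0 ≤ lam i + t * c i := by
  classical
  obtain ⟨k₀, hk₀⟩ := hc
  obtain ⟨k, hk, hmin⟩ := Finset.exists_min_image (Finset.univ.filter fun i => c i < 0)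
    (fun i => lam i / (-c i)) ⟨k₀, by simpa using hk₀⟩
  have hk : c k < 0 := by simpa using hk
  refine ⟨lam k / (-c k), k, hk, by field_simp [hk.ne]; ring, fun i => ?_⟩
  have ht : 0 ≤ lam k / (-c k) := div_nonneg (hlam k) (by linarith)
  rcases lt_or_ge (c i) 0 with hi | hi
  · have h := hmin i (by simpa using hi)
    rw [le_div_iff₀ (by linarith)] at h
    linarith
  · exact add_nonneg (hlam i) (mul_nonneg ht hi)

open Classical in
/-- If `c` spans the linear relations between the `x i`, exactly one of the facets on the negative
side of `c` is hit by a generic point `u` of the positive cone. -/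
lemma card_facets_neg_eq_one {x : κ → V} {u : V} {c lam : κ → ℝ}
    (hrel : ∑ i, c i • x i = 0)
    (hker : ∀ d : κ → ℝ, ∑ i, d i • x i = 0 → ∀ i j, d i * c j = d j * c i)
    (hgen : ∀ l : κ → ℝ, ∑ i, l i • x i = u → ∀ i j, l i = 0 → l j = 0 → i = j)
    (hneg : ∃ k, c k < 0) (hlam : ∀ i, 0 ≤ lam i) (hu : ∑ i, lam i • x i = u) :
    (Finset.univ.filter fun k => c k < 0 ∧
      ∃ l : κ → ℝ, l k = 0 ∧ (∀ i, i ≠ k → 0 < l i) ∧ ∑ i, l i • x i = u).card = 1 := by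
  obtain ⟨t, k, hk, hk0, hnn⟩ := exists_nonneg_exit hlam hneg
  have hsum : ∑ i, (lam i + t * c i) • x i = u := by
    simp only [add_smul, mul_smul, Finset.sum_add_distrib, ← Finset.smul_sum, hrel, hu]
    simp
  rw [Finset.card_eq_one]
  refine ⟨k, ?_⟩
  ext m
  simp only [Finset.mem_filter, Finset.mem_univ, true_and, Finset.mem_singleton]
  constructor
  · rintro ⟨hm, l, hlm, hlpos, hl⟩
    by_contra hne
    have hd := hker (fun i => l i - (lam i + t * c i))
      (by simp only [sub_smul, Finset.sum_sub_distrib, hl, hsum, sub_self]) k m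
    have h1 : 0 < l k := hlpos k (Ne.symm hne)
    have h2 := hnn m
    simp only [hk0, hlm] at hd
    nlinarith [mul_neg_of_pos_of_neg h1 hm, mul_nonneg h2 (neg_nonneg.2 hk.le)]
  · rintro rfl
    refine ⟨hk, fun i => lam i + t * c i, hk0, fun i hi => ?_, hsum⟩
    exact lt_of_le_of_ne (hnn i) fun h => hi (hgen _ hsum _ _ h.symm hk0)

open Classical in
lemma sum_sign_facets_eq_zero {x : κ → V} {u : V} {c s : κ → ℝ}
    (hs : ∀ i, 0 < s i) (hcs : ∑ i, c i * s i = 0)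
    (hrel : ∑ i, c i • x i = 0)
    (hker : ∀ d : κ → ℝ, ∑ i, d i • x i = 0 → ∀ i j, d i * c j = d j * c i)
    (hgen : ∀ l : κ → ℝ, ∑ i, l i • x i = u → ∀ i j, l i = 0 → l j = 0 → i = j) :
    ∑ k, (if ∃ l : κ → ℝ, l k = 0 ∧ (∀ i, i ≠ k → 0 < l i) ∧ ∑ i, l i • x i = u
      then (SignType.sign (c k) : ℤ) else 0) = 0 := by
  by_cases hP : ∃ k, ∃ l : κ → ℝ, l k = 0 ∧ (∀ i, i ≠ k → 0 < l i) ∧ ∑ i, l i • x i = u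
  swap
  · push Not at hP
    refine Finset.sum_eq_zero fun k _ => if_neg ?_
    push Not
    exact hP k
  by_cases hc : ∀ k, c k = 0
  · simp [hc]
  obtain ⟨k₀, l₀, h0, hpos, hu⟩ := hP
  have hl₀ : ∀ i, 0 ≤ l₀ i := fun i => by
    by_cases h : i = k₀
    · rw [h, h0]
    · exact (hpos i h).le
  push Not at hc
  obtain ⟨k₁, hk₁⟩ := hc
  have hneg : ∃ k, c k < 0 := by
    by_contra! h
    have := (Finset.sum_eq_zero_iff_of_nonneg fun i _ => mul_nonneg (h i) (hs i).le).1 hcs k₁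
      (Finset.mem_univ _)
    exact (mul_ne_zero hk₁ (hs k₁).ne') this
  have hpos' : ∃ k, (-c) k < 0 := by
    by_contra! h
    have := (Finset.sum_eq_zero_iff_of_nonneg (f := fun i => (-c) i * s i)
      fun i _ => mul_nonneg (h i) (hs i).le).1 (by simpa using hcs) k₁ (Finset.mem_univ _)
    simp [hk₁, (hs k₁).ne'] at this
  have h1 := card_facets_neg_eq_one hrel hker hgen hneg hl₀ hu
  have h2 := card_facets_neg_eq_one (c := -c) (by simpa using hrel)
    (fun d hd i j => by simpa using hker d hd i j) hgen hpos' hl₀ hu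
  have key : ∀ k, (if ∃ l : κ → ℝ, l k = 0 ∧ (∀ i, i ≠ k → 0 < l i) ∧ ∑ i, l i • x i = u
      then (SignType.sign (c k) : ℤ) else 0) =
      (if (-c) k < 0 ∧ ∃ l : κ → ℝ, l k = 0 ∧ (∀ i, i ≠ k → 0 < l i) ∧ ∑ i, l i • x i = u
        then 1 else 0) -
      (if c k < 0 ∧ ∃ l : κ → ℝ, l k = 0 ∧ (∀ i, i ≠ k → 0 < l i) ∧ ∑ i, l i • x i = u
        then 1 else 0) := by
    intro k
    by_cases hk : ∃ l : κ → ℝ, l k = 0 ∧ (∀ i, i ≠ k → 0 < l i) ∧ ∑ i, l i • x i = u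
    · rcases lt_trichotomy (c k) 0 with h | h | h
      · simp [hk, h, not_lt.2 h.le]
      · simp [hk, h]
      · simp [hk, h, not_lt.2 h.le]
    · simp [hk]
  rw [Finset.sum_congr rfl fun k _ => key k, Finset.sum_sub_distrib, Finset.sum_boole,
    Finset.sum_boole, h1, h2, sub_self]

open Classical in
/-- The sign of the determinant of the rows `v i` if the all-ones vector lies in the
open cone they span, and `0` otherwise. -/
noncomputable def coneSign (v : ι → ι → ℝ) : ℤ :=
  if ∃ l : ι → ℝ, (∀ i, 0 < l i) ∧ ∑ i, l i • v i = 1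
  then (SignType.sign (Matrix.of v).det : ℤ) else 0

lemma det_of_update_update_self (v : ι → ι → ℝ) (w : ι → ℝ) {k l : ι} (hkl : k ≠ l) :
    (Matrix.of (Function.update (Function.update v k w) l (v k))).det =
      -(Matrix.of (Function.update v l w)).det := by
  have : Matrix.of (Function.update (Function.update v k w) l (v k)) =
      (Matrix.of (Function.update v l w)).submatrix (Equiv.swap k l) id := by
    ext i j
    simp only [Matrix.of_apply, Matrix.submatrix_apply, id]
    by_cases hi : i = l
    · subst hi
      simp [hkl]
    · by_cases hi' : i = k
      · subst hi'
        simp [hkl]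
      · simp [hi, hi', Equiv.swap_apply_of_ne_of_ne]
  rw [this, Matrix.det_permute, Equiv.Perm.sign_swap hkl]
  simp

lemma det_of_update_sum (v : ι → ι → ℝ) (l : ι) (d : ι → ℝ) (x : ι → ι → ℝ) :
    (Matrix.of (Function.update v l (∑ i, d i • x i))).det =
      ∑ i, d i * (Matrix.of (Function.update v l (x i))).det := by
  change Matrix.detRowAlternating (Function.update v l (∑ i, d i • x i)) =
    ∑ i, d i * Matrix.detRowAlternating (Function.update v l (x i))
  simp [AlternatingMap.map_update_sum, AlternatingMap.map_update_smul]

lemma det_of_eq_zero_of_eq (v : ι → ι → ℝ) {k l : ι} (hkl : k ≠ l) (h : v k = v l) :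
    (Matrix.of v).det = 0 :=
  Matrix.det_zero_of_row_eq hkl h

lemma det_of_update_update_eq (v : ι → ι → ℝ) (w : ι → ℝ) {k l : ι} (hkl : k ≠ l) :
    (Matrix.of (Function.update (Function.update v k w) l w)).det = 0 :=
  det_of_eq_zero_of_eq _ hkl (by simp [hkl])

/-- Cramer rule: the replacement determinants are the coordinates of `w`. -/
lemma sum_det_update_smul (v : ι → ι → ℝ) (w : ι → ℝ) :
    ∑ k, (Matrix.of (Function.update v k w)).det • v k = (Matrix.of v).det • w := by
  have h := Matrix.mulVec_cramer (Matrix.of v).transpose w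
  rw [Matrix.det_transpose] at h
  rw [← h]
  ext j
  simp [Matrix.mulVec, dotProduct, Matrix.cramer_transpose_apply, Matrix.updateRow, mul_comm]
  rfl

lemma det_of_update_relation {v : ι → ι → ℝ} {w : ι → ℝ} {d : ι → ℝ} {e : ℝ}
    (h : e • w + ∑ i, d i • v i = 0) (k : ι) :
    e * (Matrix.of (Function.update v k w)).det = -(d k * (Matrix.of v).det) := by
  have h0 : ∑ i, d i • v i = (-e) • w := by
    rw [neg_smul]; exact (neg_eq_of_add_eq_zero_right h).symm
  have h1 := det_of_update_sum v k d v
  rw [h0] at h1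
  have h2 := det_of_update_sum v k (fun i => if i = k then -e else 0) (fun _ => w)
  simp only [ite_smul, zero_smul, Finset.sum_ite_eq', Finset.mem_univ, if_true, ite_mul,
    zero_mul] at h2
  rw [h2, Finset.sum_eq_single k] at h1
  · rw [Function.update_eq_self] at h1
    linarith
  · intro i _ hi
    rw [det_of_eq_zero_of_eq _ hi (by simp [hi]), mul_zero]
  · simp

lemma det_of_update_relation' {v : ι → ι → ℝ} {w : ι → ℝ} {d : ι → ℝ} {e : ℝ}
    (h : e • w + ∑ i, d i • v i = 0) {k l : ι} (hkl : k ≠ l) :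
    d l * (Matrix.of (Function.update v k w)).det =
      d k * (Matrix.of (Function.update v l w)).det := by
  have h0 : ∑ i, d i • v i = (-e) • w := by
    rw [neg_smul]; exact (neg_eq_of_add_eq_zero_right h).symm
  have h1 := det_of_update_sum (Function.update v k w) l d v
  rw [h0] at h1
  have h2 := det_of_update_sum (Function.update v k w) l (fun i => if i = k then -e else 0)
    (fun _ => w)
  simp only [ite_smul, zero_smul, Finset.sum_ite_eq', Finset.mem_univ, if_true, ite_mul,
    zero_mul] at h2
  rw [h2, det_of_update_update_eq _ _ hkl, Finset.sum_eq_add k l hkl] at h1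
  · rw [det_of_update_update_self _ _ hkl] at h1
    have : Function.update (Function.update v k w) l (v l) = Function.update v k w := by
      rw [Function.update_comm hkl, Function.update_eq_self]
    rw [this] at h1
    linarith
  · intro i _ hi
    rw [det_of_eq_zero_of_eq _ hi.2 (by simp [hi.1, hi.2]), mul_zero]
  · simp
  · simp

/-- Replacing in turn each generator of a cone by `w` preserves the signed incidence with a
generic point. -/
lemma coneSign_eq_sum_update {v : ι → ι → ℝ} {w : ι → ℝ}
    (hv : ∀ i, 0 < ∑ j, v i j) (hw : 0 < ∑ j, w j)
    (hgen : ∀ l : Option ι → ℝ, ∑ i, l i • (i.elim w v) = 1 →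
      ∀ i j, l i = 0 → l j = 0 → i = j) :
    coneSign v = ∑ k, coneSign (Function.update v k w) := by
  classical
  have hrel := sum_det_update_smul v w
  have main := sum_sign_facets_eq_zero (κ := Option ι) (x := fun i => i.elim w v) (u := 1)
    (c := fun i => i.elim (-(Matrix.of v).det) fun k => (Matrix.of (Function.update v k w)).det)
    (s := fun i => i.elim (∑ j, w j) fun k => ∑ j, v k j)
    (by rintro (_ | i); exacts [hw, hv i])
    (by
      have := congrArg (fun f : ι → ℝ => ∑ j, f j) hrel
      simp only [Finset.sum_apply, Pi.smul_apply, smul_eq_mul] at this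
      rw [Finset.sum_comm, ← Finset.mul_sum] at this
      simp only [← Finset.mul_sum] at this
      simp only [Fintype.sum_option, Option.elim]
      linarith)
    (by
      simp only [Fintype.sum_option, Option.elim]
      rw [hrel]; simp)
    (by
      intro d hd
      simp only [Fintype.sum_option, Option.elim] at hd
      have r1 := fun k => det_of_update_relation hd k
      rintro (_ | i) (_ | j)
      · rfl
      · have := r1 j
        simp only [Option.elim]
        linarith
      · have := r1 i
        simp only [Option.elim]
        linarith
      · by_cases hij : i = j
        · rw [hij]
        · exact (det_of_update_relation' hd (Ne.symm hij)))
    hgen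
  rw [Fintype.sum_option] at main
  have hnone : (∃ l : Option ι → ℝ, l none = 0 ∧ (∀ i, i ≠ none → 0 < l i) ∧
      ∑ i, l i • (i.elim w v) = 1) ↔ ∃ l : ι → ℝ, (∀ i, 0 < l i) ∧ ∑ i, l i • v i = 1 := by
    constructor
    · rintro ⟨l, h0, hp, hs⟩
      refine ⟨fun i => l (some i), fun i => hp _ (by simp), ?_⟩
      simpa [Fintype.sum_option, h0] using hs
    · rintro ⟨l, hp, hs⟩
      refine ⟨fun i => i.elim 0 l, rfl, ?_, by simpa [Fintype.sum_option] using hs⟩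
      rintro (_ | i) hi
      exacts [absurd rfl hi, hp i]
  have hsome : ∀ k, (∃ l : Option ι → ℝ, l (some k) = 0 ∧ (∀ i, i ≠ some k → 0 < l i) ∧
      ∑ i, l i • (i.elim w v) = 1) ↔
      ∃ l : ι → ℝ, (∀ i, 0 < l i) ∧ ∑ i, l i • (Function.update v k w) i = 1 := by
    intro k
    constructor
    · rintro ⟨l, h0, hp, hs⟩
      refine ⟨fun i => if i = k then l none else l (some i), fun i => ?_, ?_⟩
      · by_cases h : i = k
        · simpa [h] using hp none (by simp)
        · simpa [h] using hp (some i) (by simpa using h)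
      · rw [← hs, Fintype.sum_option, ← Finset.add_sum_erase _ _ (Finset.mem_univ k),
          ← Finset.add_sum_erase (a := k) _ (fun i => l (some i) • Option.elim (some i) w v)
            (Finset.mem_univ k)]
        simp only [h0, if_true, Function.update_self, Option.elim, zero_smul, zero_add]
        congr 1
        refine Finset.sum_congr rfl fun i hi => ?_
        simp [Finset.ne_of_mem_erase hi]
    · rintro ⟨l, hp, hs⟩
      refine ⟨fun i => i.elim (l k) fun i => if i = k then 0 else l i, by simp, ?_, ?_⟩
      · rintro (_ | i) hi
        · exact hp k
        · have : i ≠ k := by simpa using hi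
          simpa [this] using hp i
      · rw [← hs, Fintype.sum_option, ← Finset.add_sum_erase _ _ (Finset.mem_univ k),
          ← Finset.add_sum_erase (a := k) _ (fun i => l i • Function.update v k w i)
            (Finset.mem_univ k)]
        simp only [if_true, Function.update_self, Option.elim, zero_smul, zero_add]
        congr 1
        refine Finset.sum_congr rfl fun i hi => ?_
        simp [Finset.ne_of_mem_erase hi]
  simp only [hnone, hsome] at main
  simp only [Option.elim_none, Option.elim_some, Left.sign_neg] at main
  unfold coneSign
  by_cases h : ∃ l : ι → ℝ, (∀ i, 0 < l i) ∧ ∑ i, l i • v i = 1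
  · rw [if_pos h, SignType.coe_neg] at main
    rw [if_pos h]
    linarith
  · rw [if_neg h] at main
    rw [if_neg h]
    linarith

lemma coneSign_comp_swap (v : ι → ι → ℝ) {k l : ι} (hkl : k ≠ l) :
    coneSign (v ∘ Equiv.swap k l) = -coneSign v := by
  have hdet : (Matrix.of (v ∘ Equiv.swap k l)).det = -(Matrix.of v).det := by
    have : Matrix.of (v ∘ Equiv.swap k l) = (Matrix.of v).submatrix (Equiv.swap k l) id := rfl
    rw [this, Matrix.det_permute, Equiv.Perm.sign_swap hkl]
    simp
  have hcone : (∃ m : ι → ℝ, (∀ i, 0 < m i) ∧ ∑ i, m i • (v ∘ Equiv.swap k l) i = 1) ↔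
      ∃ m : ι → ℝ, (∀ i, 0 < m i) ∧ ∑ i, m i • v i = 1 := by
    constructor
    · rintro ⟨m, hm, hs⟩
      refine ⟨m ∘ Equiv.swap k l, fun i => hm _, ?_⟩
      rw [← hs, ← Equiv.sum_comp (Equiv.swap k l)]
      simp
    · rintro ⟨m, hm, hs⟩
      refine ⟨m ∘ Equiv.swap k l, fun i => hm _, ?_⟩
      rw [← hs, ← Equiv.sum_comp (Equiv.swap k l) (fun i => m i • v i)]
      simp
  unfold coneSign
  rw [hdet, hcone, Left.sign_neg, SignType.coe_neg]
  split_ifs <;> simp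

/-- Permuting rows and columns simultaneously does not change the signed incidence. -/
lemma coneSign_reindex (v : ι → ι → ℝ) (e : Equiv.Perm ι) :
    coneSign (fun i j => v (e i) (e j)) = coneSign v := by
  have hdet : (Matrix.of fun i j => v (e i) (e j)).det = (Matrix.of v).det :=
    Matrix.det_submatrix_equiv_self e (Matrix.of v)
  have hcone : (∃ m : ι → ℝ, (∀ i, 0 < m i) ∧ ∑ i, m i • (fun j => v (e i) (e j)) = 1) ↔
      ∃ m : ι → ℝ, (∀ i, 0 < m i) ∧ ∑ i, m i • v i = 1 := by
    constructor
    · rintro ⟨m, hm, hs⟩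
      refine ⟨m ∘ e.symm, fun i => hm _, ?_⟩
      ext j
      have := congrFun hs (e.symm j)
      rw [← Equiv.sum_comp e]
      simpa using this
    · rintro ⟨m, hm, hs⟩
      refine ⟨m ∘ e, fun i => hm _, ?_⟩
      ext j
      have := congrFun hs (e j)
      rw [← Equiv.sum_comp e] at this
      simpa using this
  unfold coneSign
  rw [hdet, hcone]

end ConeSign

lemma update_colour {ι : Type*} [DecidableEq ι] (x : ι → ι → ι → ℝ) (π : Equiv.Perm ι) (a : ι)
    (y : ι → ι → ℝ) :
    (fun i => Function.update x a y (π i) i) =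
      Function.update (fun i => x (π i) i) (π.symm a) (y (π.symm a)) := by
  ext i j
  by_cases h : i = π.symm a
  · subst h; simp
  · have h' : π i ≠ a := fun h' => h (by simp [← h'])
    simp [h, h']

section SignedCount

variable {ι : Type*} [Fintype ι] [DecidableEq ι]

/-- The sum of `coneSign` over all assignments of colours to rows, where `x a i` is the vector
of colour `a` placed in row `i`. -/
noncomputable def signedCount (x : ι → ι → ι → ℝ) : ℤ :=
  ∑ π : Equiv.Perm ι, coneSign fun i => x (π i) i

lemma signedCount_comp_perm (x : ι → ι → ι → ℝ) (σ : Equiv.Perm ι) :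
    signedCount (fun a => x (σ a)) = signedCount x :=
  Equiv.sum_comp (Equiv.mulLeft σ) fun π : Equiv.Perm ι => coneSign fun i => x (π i) i

/-- A point configuration is generic with respect to the all-ones vector if no combination
giving that vector has two vanishing coefficients. -/
def IsGenericFamily {κ : Type*} [Fintype κ] (x : κ → ι → ℝ) : Prop :=
  ∀ l : κ → ℝ, ∑ i, l i • x i = 1 → ∀ i j, l i = 0 → l j = 0 → i = j

lemma signedCount_eq_sum_update {x : ι → ι → ι → ℝ} {q : ι → ℝ}
    (hx : ∀ a i, 0 < ∑ j, x a i j) (hq : 0 < ∑ j, q j)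
    (hgen : ∀ π : Equiv.Perm ι,
      IsGenericFamily fun i : Option ι => i.elim q fun i => x (π i) i) :
    signedCount x = ∑ a, signedCount (Function.update x a fun _ => q) := by
  simp only [signedCount]
  rw [Finset.sum_comm]
  refine Finset.sum_congr rfl fun π _ => ?_
  rw [coneSign_eq_sum_update (fun i => hx _ _) hq (hgen π), ← Equiv.sum_comp π.symm]
  exact Finset.sum_congr rfl fun a _ => by rw [update_colour]

end SignedCount

section Equivariance

variable {G : Type*} [AddCommGroup G] [Fintype G] [DecidableEq G]

lemma sum_perm_eq_card_mul {R : Equiv.Perm G → ℤ}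
    (hR : ∀ (π : Equiv.Perm G) (c : G), R (π * Equiv.addRight c) = R π) :
    ∑ π, R π = Fintype.card G * ∑ π with π 0 = 0, R π := by
  rw [← Finset.sum_fiberwise Finset.univ (fun π : Equiv.Perm G => π.symm 0) R]
  have : ∀ b : G, ∑ π with π.symm 0 = b, R π = ∑ π with π 0 = 0, R π := by
    intro b
    refine Finset.sum_equiv (Equiv.mulRight (Equiv.addRight b)) (fun π => ?_) fun π _ =>
      (hR π b).symm
    simp only [Finset.mem_filter, Finset.mem_univ, true_and, Equiv.coe_mulRight,
      Equiv.Perm.coe_mul, Function.comp_apply, Equiv.coe_addRight, zero_add]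
    rw [Equiv.symm_apply_eq, eq_comm]
  simp [this]

lemma card_perm_fix_zero :
    (Finset.univ.filter fun π : Equiv.Perm G => π 0 = 0).card =
      (Fintype.card G - 1).factorial := by
  have h := sum_perm_eq_card_mul (G := G) (R := fun _ => 1) fun _ _ => rfl
  simp only [Finset.sum_const, Finset.card_univ, Fintype.card_perm, nsmul_eq_mul, mul_one] at h
  have hpos : 0 < Fintype.card G := Fintype.card_pos
  rw [← Nat.mul_factorial_pred hpos.ne'] at h
  exact (Nat.eq_of_mul_eq_mul_left hpos (by exact_mod_cast h)).symm

/-- Replacing the measure of one colour changes the signed count by a multiple of `|G|`. -/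
lemma card_dvd_signedCount_sub_update {x : G → G → G → ℝ} {q : G → ℝ} {y : G → G → ℝ} {s : G}
    (hs : s ≠ 0) (hx0 : ∀ i, x 0 i = q)
    (hx : ∀ a, a ≠ 0 → ∀ c i j, x a (i + c) (j + c) = x a i j)
    (hy : ∀ c i j, y (i + c) (j + c) = y i j)
    (hxpos : ∀ a i, 0 < ∑ j, x a i j) (hypos : ∀ i, 0 < ∑ j, y i j)
    (hgen : ∀ π : Equiv.Perm G,
      IsGenericFamily fun i : Option G => i.elim (y (π.symm s)) fun i => x (π i) i) :
    (Fintype.card G : ℤ) ∣ signedCount x - signedCount (Function.update x s y) := by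
  let h : G → Equiv.Perm G → ℤ := fun a π =>
    coneSign (Function.update (fun i => x (π i) i) (π.symm a) (y (π.symm s)))
  have h1 : signedCount x = ∑ a, ∑ π, h a π := by
    rw [signedCount, Finset.sum_comm]
    refine Finset.sum_congr rfl fun π _ => ?_
    rw [coneSign_eq_sum_update (fun i => hxpos _ _) (hypos _) (hgen π), ← Equiv.sum_comp π.symm]
  have h_s : ∑ π, h s π = signedCount (Function.update x s y) :=
    Finset.sum_congr rfl fun π _ => by simp only [h, update_colour]
  have h_other : ∀ a, a ≠ 0 ∧ a ≠ s → ∑ π, h a π = 0 := by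
    rintro a ⟨ha0, has⟩
    have hneg : ∀ π, h a (Equiv.swap 0 a * π) = -h a π := by
      intro π
      have hne : π.symm 0 ≠ π.symm a := fun h => ha0 (π.symm.injective h).symm
      have e1 : (Equiv.swap 0 a * π).symm a = π.symm 0 := by
        simp [Equiv.symm_apply_eq]
      have e2 : (Equiv.swap 0 a * π).symm s = π.symm s := by
        simp [Equiv.symm_apply_eq, Equiv.swap_apply_of_ne_of_ne hs has.symm]
      simp only [h]
      rw [e1, e2, ← coneSign_comp_swap _ hne]
      congr 1
      ext i : 1
      by_cases hi : i = π.symm 0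
      · subst hi
        simp
      · by_cases hi' : i = π.symm a
        · subst hi'
          simp [hne, hne.symm, hx0]
        · have n1 : π i ≠ 0 := fun h => hi (by simp [← h])
          have n2 : π i ≠ a := fun h => hi' (by simp [← h])
          simp [hi, hi', n1, n2, Equiv.swap_apply_of_ne_of_ne]
    have := Equiv.sum_comp (Equiv.mulLeft (Equiv.swap 0 a)) (h a)
    simp only [Equiv.coe_mulLeft, hneg, Finset.sum_neg_distrib] at this
    linarith
  have h_0 : (Fintype.card G : ℤ) ∣ ∑ π, h 0 π := by
    rw [sum_perm_eq_card_mul]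
    · exact dvd_mul_right _ _
    intro π c
    simp only [h]
    rw [← coneSign_reindex (Function.update (fun i => x (π i) i) (π.symm 0) (y (π.symm s)))
      (Equiv.addRight c)]
    congr 1
    ext i j
    by_cases hi : i + c = π.symm 0
    · have : i = (π * Equiv.addRight c).symm 0 := by
        rw [Equiv.eq_symm_apply]; simp [hi]
      rw [← this]
      have hsy : π.symm s = (π * Equiv.addRight c).symm s + c := by
        rw [Equiv.symm_apply_eq]
        exact ((π * Equiv.addRight c).apply_symm_apply s).symm
      simp [hi, hsy, hy]
    · have n1 : i ≠ (π * Equiv.addRight c).symm 0 := by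
        rintro rfl
        apply hi
        rw [Equiv.eq_symm_apply]
        exact (π * Equiv.addRight c).apply_symm_apply 0
      have n2 : π (i + c) ≠ 0 := fun h => hi (by simp [← h])
      simp [hi, n1, hx _ n2]
  rw [h1, ← Finset.add_sum_erase _ _ (Finset.mem_univ s), h_s, add_sub_cancel_left,
    Finset.sum_eq_single 0]
  · exact h_0
  · exact fun a ha ha0 => h_other a ⟨ha0, Finset.ne_of_mem_erase ha⟩
  · intro h; simp [hs.symm] at h

lemma signedCount_basis :
    signedCount (fun a i : G => if a = 0 then (Pi.single 0 1 : G → ℝ) else Pi.single i 1) =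
      (Fintype.card G - 1).factorial := by
  rw [← card_perm_fix_zero, signedCount, Finset.card_filter, Nat.cast_sum]
  refine Finset.sum_congr rfl fun π _ => ?_
  by_cases h : π 0 = 0
  · have hv : (fun i => if π i = 0 then (Pi.single 0 1 : G → ℝ) else Pi.single i 1) =
        fun i => Pi.single i 1 := by
      ext i : 1
      split_ifs with hi
      · rw [π.injective (hi.trans h.symm)]
      · rfl
    have h1 : Matrix.of (fun i : G => (Pi.single i 1 : G → ℝ)) = 1 := by
      ext i j
      simp [Matrix.one_apply, Pi.single_apply, eq_comm]
    have hone : ∑ i : G, (1 : G → ℝ) i • (Pi.single i 1 : G → ℝ) = 1 := by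
      ext j
      simp [Pi.single_apply]
    rw [hv, coneSign, h1, if_pos ⟨1, fun _ => one_pos, hone⟩]
    simp [h]
  · have h0 : (0 : G) ≠ π.symm 0 := fun h' => h (by simpa using congrArg π h')
    rw [coneSign, det_of_eq_zero_of_eq _ h0 (by simp [h])]
    simp [h]

end Equivariance

section SubsetSums

variable {J : Type*} [Fintype J] [DecidableEq J]

lemma sum_sum_erase_eq (φ f : Finset J → ℤ) :
    ∑ T : Finset J, φ T * ∑ t ∈ T, f (T.erase t) =
      ∑ S : Finset J, f S * ∑ t ∈ Sᶜ, φ (insert t S) := by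
  simp only [Finset.mul_sum]
  rw [Finset.sum_comm' (t' := Finset.univ) (s' := fun t => Finset.univ.filter fun T => t ∈ T)
      (by simp),
    Finset.sum_comm' (s := Finset.univ) (t' := Finset.univ) (t := fun S => Sᶜ)
      (s' := fun t => Finset.univ.filter fun S => t ∉ S) (by simp)]
  refine Finset.sum_congr rfl fun t _ => ?_
  refine Finset.sum_nbij' (fun T => T.erase t) (fun S => insert t S) ?_ ?_ ?_ ?_ ?_
  · simp
  · simp
  · intro T hT
    exact Finset.insert_erase (by simpa using hT)
  · intro S hS
    exact Finset.erase_insert (by simpa using hS)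
  · intro T hT
    rw [Finset.insert_erase (by simpa using hT), mul_comm]

/-- The inclusion matrix between the two middle layers of a set of size `2 * k + 1` is injective. -/
lemma eq_zero_of_sum_erase_eq_zero {k : ℕ} (hJ : Fintype.card J = 2 * k + 1)
    {f : Finset J → ℤ} (hf : ∀ T : Finset J, T.card = k + 1 → ∑ t ∈ T, f (T.erase t) = 0)
    {S₀ : Finset J} (hS₀ : S₀.card = k) : f S₀ = 0 := by
  let F : ℕ → ℤ := fun m => ∑ S : Finset J with S.card = k ∧ (S \ S₀).card = m, f S
  have hcompl : S₀ᶜ.card = k + 1 := by rw [Finset.card_compl]; omega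
  have step : ∀ m ≤ k, ((k : ℤ) + 1 - m) * F m + (m + 1) * F (m + 1) = 0 := by
    intro m hm
    have h := sum_sum_erase_eq
      (fun T : Finset J => if T.card = k + 1 ∧ (T \ S₀).card = m + 1 then 1 else 0) f
    rw [Finset.sum_eq_zero] at h
    swap
    · intro T _
      split_ifs with hT
      · rw [hf T hT.1, mul_zero]
      · rw [zero_mul]
    rw [h]
    simp only [F, Finset.sum_filter]
    rw [Finset.mul_sum, Finset.mul_sum, ← Finset.sum_add_distrib]
    refine Finset.sum_congr rfl fun S _ => ?_
    by_cases hS : S.card = k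
    swap
    · rw [Finset.sum_eq_zero]
      · simp [hS]
      · intro t ht
        have : t ∉ S := by simpa using ht
        simp [this, hS]
    have hsplit : (Sᶜ : Finset J) = (S₀ \ S) ∪ (S ∪ S₀)ᶜ := by
      ext t; simp; tauto
    have hdisj : Disjoint (S₀ \ S) (S ∪ S₀)ᶜ := by
      rw [Finset.disjoint_left]; intro t; simp; tauto
    have c1 : (S₀ \ S).card = (S \ S₀).card := by
      have h1 := Finset.card_sdiff_add_card_inter S S₀
      have h2 := Finset.card_sdiff_add_card_inter S₀ S
      rw [Finset.inter_comm] at h2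
      omega
    have c2 : (S ∪ S₀)ᶜ.card + (S \ S₀).card = k + 1 := by
      have h1 := Finset.card_sdiff_add_card S S₀
      have h2 := Finset.card_compl_add_card (S ∪ S₀)
      omega
    have i1 : ∑ t ∈ S₀ \ S, (if (insert t S).card = k + 1 ∧ (insert t S \ S₀).card = m + 1
        then (1 : ℤ) else 0) = if (S \ S₀).card = m + 1 then (m + 1 : ℤ) else 0 := by
      rw [Finset.sum_congr rfl (g := fun _ => if (S \ S₀).card = m + 1 then (1 : ℤ) else 0)]
      · rw [Finset.sum_const, c1]
        split_ifs with h <;> simp [h]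
      · intro t ht
        rw [Finset.mem_sdiff] at ht
        rw [Finset.insert_sdiff_of_mem _ ht.1]
        simp [ht.2, hS]
    have i2 : ∑ t ∈ (S ∪ S₀)ᶜ, (if (insert t S).card = k + 1 ∧ (insert t S \ S₀).card = m + 1
        then (1 : ℤ) else 0) = if (S \ S₀).card = m then (k + 1 - m : ℤ) else 0 := by
      rw [Finset.sum_congr rfl (g := fun _ => if (S \ S₀).card = m then (1 : ℤ) else 0)]
      · rw [Finset.sum_const]
        split_ifs with h
        · rw [nsmul_eq_mul, mul_one]
          rw [h] at c2
          rw [eq_sub_iff_add_eq]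
          exact_mod_cast c2
        · simp
      · intro t ht
        have ht : t ∉ S ∧ t ∉ S₀ := by simpa using ht
        rw [Finset.insert_sdiff_of_notMem _ ht.2, Finset.card_insert_of_notMem ht.1,
          Finset.card_insert_of_notMem (by simp [ht.1])]
        simp [hS]
    rw [hsplit, Finset.sum_union hdisj, i1, i2]
    simp only [hS, true_and]
    split_ifs <;> ring
  have top : F (k + 1) = 0 := by
    refine Finset.sum_eq_zero fun S hS => ?_
    have hS := (Finset.mem_filter.1 hS).2
    have := Finset.card_le_card (Finset.sdiff_subset (s := S) (t := S₀))
    omega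
  have down : ∀ d ≤ k + 1, F (k + 1 - d) = 0 := by
    intro d
    induction d with
    | zero => intro _; exact top
    | succ d ih =>
      intro hd
      have h := step (k + 1 - (d + 1)) (by omega)
      rw [show k + 1 - (d + 1) + 1 = k + 1 - d by omega, ih (by omega), mul_zero, add_zero,
        mul_eq_zero] at h
      refine h.resolve_left ?_
      omega
  have h0 := down (k + 1) le_rfl
  rw [Nat.sub_self] at h0
  rw [← h0]
  simp only [F]
  rw [Finset.sum_eq_single S₀]
  · intro S hS hne
    have hS := (Finset.mem_filter.1 hS).2
    rw [Finset.card_eq_zero, Finset.sdiff_eq_empty_iff_subset] at hS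
    exact absurd (Finset.eq_of_subset_of_card_le hS.2 (by omega)) hne
  · intro h
    simp [hS₀] at h

end SubsetSums

section Genericity

variable {J G : Type*} [DecidableEq J] [AddCommGroup G] [Fintype G] [DecidableEq G]

/-- The translate by `i` of the Dirac measure at `0` (colour `none`) or of `μ j`
(colour `some j`). -/
def shifted (μ : J → G → ℝ) : Option J × G → G → ℝ
  | (none, i) => Pi.single i 1
  | (some j, i) => fun z => μ j (z - i)

/-- The all-ones vector is not in the span of fewer than `|G|` translates, where each of the
colours `j` is used at most once and only colours in `A` are used. -/
def IsGenericOn (μ : J → G → ℝ) (A : Finset J) : Prop :=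
  ∀ B : Finset (Option J × G), B.card < Fintype.card G →
    (∀ j i i', (some j, i) ∈ B → (some j, i') ∈ B → i = i') →
    (∀ j i, (some j, i) ∈ B → j ∈ A) →
    (1 : G → ℝ) ∉ Submodule.span ℝ (shifted μ '' B)

lemma isGenericOn_empty (μ : J → G → ℝ) : IsGenericOn μ ∅ := by
  intro B hB _ hA h1
  obtain ⟨z, hz⟩ : ∃ z : G, (none, z) ∉ B := by
    by_contra! h
    have := Finset.card_le_card_of_injOn (s := Finset.univ) (t := B)
      (fun z : G => ((none : Option J), z)) (by intro z _; exact h z)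
      (by intro a _ b _ hab; simpa using hab)
    rw [Finset.card_univ] at this
    omega
  have hle : Submodule.span ℝ (shifted μ '' B) ≤
      LinearMap.ker (LinearMap.proj (R := ℝ) (φ := fun _ : G => ℝ) z) := by
    rw [Submodule.span_le]
    rintro _ ⟨⟨_ | j, i⟩, hb, rfl⟩
    · have : z ≠ i := by rintro rfl; exact hz hb
      simp [shifted, this]
    · exact absurd (hA j i hb) (Finset.notMem_empty j)
  simpa using hle h1

lemma dense_compl_of_ne_top {V : Type*} [NormedAddCommGroup V] [NormedSpace ℝ V]
    {W : Submodule ℝ V} (hW : W ≠ ⊤) : Dense (W : Set V)ᶜ := by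
  rw [← interior_eq_empty_iff_dense_compl]
  by_contra h
  exact hW (W.eq_top_of_nonempty_interior' (Set.nonempty_iff_ne_empty.2 h))

lemma exists_mem_notMem_submodules {V κ : Type*} [NormedAddCommGroup V] [NormedSpace ℝ V]
    [FiniteDimensional ℝ V] [Finite κ] {W : κ → Submodule ℝ V} (hW : ∀ k, W k ≠ ⊤) {U : Set V}
    (hU : IsOpen U) (hne : U.Nonempty) : ∃ y ∈ U, ∀ k, y ∉ W k := by
  have := FiniteDimensional.complete ℝ V
  have hd : Dense (⋂ k, (W k : Set V)ᶜ) :=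
    dense_iInter_of_isOpen
      (fun k => (Submodule.closed_of_finiteDimensional (W k)).isOpen_compl)
      (fun k => dense_compl_of_ne_top (hW k))
  obtain ⟨y, hyU, hy⟩ := hd.inter_open_nonempty U hU hne
  exact ⟨y, hyU, by simpa using hy⟩

variable [Fintype J]

/-- Translation of functions as a linear equivalence. -/
def shiftEquiv (i : G) : (G → ℝ) ≃ₗ[ℝ] (G → ℝ) :=
  LinearEquiv.funCongrLeft ℝ ℝ (Equiv.subRight i)

lemma exists_isGenericOn {U : J → Set (G → ℝ)} (hU : ∀ j, IsOpen (U j))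
    (hne : ∀ j, (U j).Nonempty) (A : Finset J) :
    ∃ μ : J → G → ℝ, (∀ j, μ j ∈ U j) ∧ IsGenericOn μ A := by
  classical
  induction A using Finset.induction_on with
  | empty =>
    choose μ hμ using hne
    exact ⟨μ, hμ, isGenericOn_empty μ⟩
  | insert j A hj ih =>
    obtain ⟨μ, hμU, hμ⟩ := ih
    let W : {B : Finset (Option J × G) // B.card + 1 < Fintype.card G} × G →
        Submodule ℝ (G → ℝ) := fun k =>
      (Submodule.span ℝ (insert 1 (shifted μ '' (k.1 : Finset (Option J × G))))).comap
        (shiftEquiv k.2).toLinearMap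
    have hW : ∀ k, W k ≠ ⊤ := by
      rintro ⟨⟨B, hB⟩, i⟩ h
      have htop : Submodule.span ℝ (insert 1 (shifted μ '' (B : Set (Option J × G)))) = ⊤ := by
        rw [eq_top_iff]
        intro y _
        have : (shiftEquiv i).symm y ∈ W (⟨B, hB⟩, i) := h ▸ Submodule.mem_top
        simpa [W] using this
      have hfin := finrank_span_finset_le_card (R := ℝ) (insert 1 (B.image (shifted μ)))
      rw [Set.finrank, Finset.coe_insert, Finset.coe_image, htop, finrank_top,
        Module.finrank_fintype_fun_eq_card] at hfin
      have h1 := Finset.card_insert_le (1 : G → ℝ) (B.image (shifted μ))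
      have h2 := Finset.card_image_le (s := B) (f := shifted μ)
      omega
    obtain ⟨y, hyU, hy⟩ := exists_mem_notMem_submodules hW (hU j) (hne j)
    have hagree : ∀ B : Finset (Option J × G), (∀ i, (some j, i) ∉ B) →
        shifted (Function.update μ j y) '' B = shifted μ '' (B : Set (Option J × G)) := by
      intro B hB
      refine Set.image_congr ?_
      rintro ⟨_ | j', i⟩ hb
      · rfl
      · have : j' ≠ j := by rintro rfl; exact hB i hb
        simp [shifted, this]
    refine ⟨Function.update μ j y, fun j' => ?_, ?_⟩
    · by_cases h : j' = j
      · subst h; simpa using hyU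
      · simpa [h] using hμU j'
    intro B hB hinj hA h1
    by_cases hjB : ∃ i, (some j, i) ∈ B
    swap
    · push Not at hjB
      rw [hagree B hjB] at h1
      refine hμ B hB hinj (fun j' i hi => ?_) h1
      refine Finset.mem_of_mem_insert_of_ne (hA j' i hi) ?_
      rintro rfl
      exact hjB i hi
    obtain ⟨i, hi⟩ := hjB
    have hnot : ∀ i', (some j, i') ∉ B.erase (some j, i) := by
      intro i' hi'
      obtain rfl := hinj j i i' hi (Finset.mem_of_mem_erase hi')
      exact Finset.notMem_erase _ _ hi'
    have hcard := Finset.card_erase_add_one hi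
    rw [← Finset.insert_erase hi, Finset.coe_insert, Set.image_insert_eq, hagree _ hnot,
      Submodule.mem_span_insert] at h1
    obtain ⟨a, z, hz, haz⟩ := h1
    have hshift : shifted (Function.update μ j y) (some j, i) = shiftEquiv i y := by
      ext x
      simp [shifted, shiftEquiv, LinearEquiv.funCongrLeft_apply, LinearMap.funLeft_apply]
    rw [hshift] at haz
    by_cases ha : a = 0
    · rw [ha, zero_smul, zero_add] at haz
      refine hμ (B.erase (some j, i)) (by omega) (fun j' i' i'' h h' => hinj j' i' i''
        (Finset.mem_of_mem_erase h) (Finset.mem_of_mem_erase h')) (fun j' i' hi' => ?_)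
        (haz ▸ hz)
      refine Finset.mem_of_mem_insert_of_ne (hA j' i' (Finset.mem_of_mem_erase hi')) ?_
      rintro rfl
      exact hnot i' hi'
    · refine hy (⟨B.erase (some j, i), by omega⟩, i) ?_
      have hmem : shiftEquiv i y = a⁻¹ • (1 - z) := by
        rw [haz, add_sub_cancel_right, smul_smul, inv_mul_cancel₀ ha, one_smul]
      change shiftEquiv i y ∈ Submodule.span ℝ (insert 1 (shifted μ '' _))
      rw [hmem]
      exact Submodule.smul_mem _ _ (Submodule.sub_mem _
        (Submodule.subset_span (Set.mem_insert _ _))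
        (Submodule.span_mono (Set.subset_insert _ _) hz))

lemma IsGenericOn.isGenericFamily {μ : J → G → ℝ} (hμ : IsGenericOn μ Finset.univ)
    {L : Option G → Option J × G}
    (hL : ∀ k k' j i i', L k = (some j, i) → L k' = (some j, i') → i = i') :
    IsGenericFamily fun k => shifted μ (L k) := by
  classical
  intro l hl i₀ j₀ hi hj
  by_contra hne
  have hcard : ((Finset.univ.erase i₀).erase j₀).card + 1 = Fintype.card G := by
    rw [Finset.card_erase_of_mem (by simp [Ne.symm hne]), Finset.card_erase_of_mem (by simp),
      Finset.card_univ, Fintype.card_option]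
    have : 0 < Fintype.card G := Fintype.card_pos
    omega
  have himg := Finset.card_image_le (s := (Finset.univ.erase i₀).erase j₀) (f := L)
  refine hμ (((Finset.univ.erase i₀).erase j₀).image L) (by omega) ?_ (by simp) ?_
  · intro j i i' h h'
    obtain ⟨k, _, hk⟩ := Finset.mem_image.1 h
    obtain ⟨k', _, hk'⟩ := Finset.mem_image.1 h'
    exact hL k k' j i i' hk hk'
  · rw [← hl]
    refine Submodule.sum_mem _ fun k _ => ?_
    by_cases h1 : k = i₀
    · simp [h1, hi]
    by_cases h2 : k = j₀
    · simp [h2, hj]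
    refine Submodule.smul_mem _ _ (Submodule.subset_span ⟨L k, ?_, rfl⟩)
    exact Finset.mem_coe.2 (Finset.mem_image_of_mem _ (by simp [h1, h2]))

end Genericity

section Contradiction

variable {J G : Type*} [AddCommGroup G] [DecidableEq G]

/-- The rows of a colouring `u`, with colour `0` held at the Dirac measure at `0`. -/
def colourRows (μ : J → G → ℝ) (u : G → Option J) (a i : G) : G → ℝ :=
  shifted μ (if a = 0 then (none, 0) else (u a, i))

lemma shifted_add (μ : J → G → ℝ) (o : Option J) (c i z : G) :
    shifted μ (o, i + c) (z + c) = shifted μ (o, i) z := by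
  rcases o with _ | j
  · simp [shifted, Pi.single_apply]
  · simp [shifted]

variable [Fintype G]

lemma sum_shifted_pos {μ : J → G → ℝ} (hpos : ∀ j, 0 < ∑ z, μ j z) (b : Option J × G) :
    0 < ∑ z, shifted μ b z := by
  obtain ⟨_ | j, i⟩ := b
  · simp [shifted]
  · simpa [shifted] using ((Equiv.subRight i).sum_comp (μ j)).symm ▸ hpos j

lemma signedCount_colourRows_eq_of_range_eq (μ : J → G → ℝ) {u u' : G → Option J}
    (hu : Function.Injective u) (hu' : Function.Injective u') (h0 : u 0 = u' 0)
    (hr : Set.range u = Set.range u') :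
    signedCount (colourRows μ u) = signedCount (colourRows μ u') := by
  let σ : Equiv.Perm G := (Equiv.ofInjective u' hu').trans
    ((Equiv.setCongr hr.symm).trans (Equiv.ofInjective u hu).symm)
  have hσ : ∀ a, u (σ a) = u' a := fun a => by
    simp only [σ, Equiv.trans_apply]
    rw [Equiv.apply_ofInjective_symm hu]
    rfl
  have hσ0 : ∀ a, σ a = 0 ↔ a = 0 := fun a => by
    rw [← hu.eq_iff, hσ, h0, hu'.eq_iff]
  rw [← signedCount_comp_perm _ σ]
  congr 1
  ext a i : 2
  simp [colourRows, hσ, hσ0]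

lemma exists_injective_range_eq {S : Finset J} (hS : S.card + 1 = Fintype.card G) :
    ∃ u : G → Option J, Function.Injective u ∧ u 0 = none ∧
      Set.range u = (Finset.insertNone S : Set (Option J)) := by
  have hcard : Fintype.card G = Fintype.card (Finset.insertNone S) := by
    rw [Fintype.card_coe, Finset.card_insertNone, hS]
  let e := Fintype.equivOfCardEq hcard
  let a := e.symm ⟨none, by simp⟩
  let e' : G ≃ Finset.insertNone S := (Equiv.swap 0 a).trans e
  refine ⟨fun i => e' i, Subtype.val_injective.comp e'.injective, by simp [e', a], ?_⟩
  have : (fun i => (e' i : Option J)) = Subtype.val ∘ e' := rfl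
  rw [this, Set.range_comp, e'.surjective.range_eq, Set.image_univ]
  ext; simp

variable [DecidableEq J] [Fintype J]

lemma card_dvd_signedCount_colourRows_sub {μ : J → G → ℝ} (hpos : ∀ j, 0 < ∑ z, μ j z)
    (hμ : IsGenericOn μ Finset.univ) {u : G → Option J} (hu : Function.Injective u) :
    (Fintype.card G : ℤ) ∣ signedCount (colourRows μ u) - (Fintype.card G - 1).factorial := by
  have key : ∀ X : Finset G, 0 ∉ X → (Fintype.card G : ℤ) ∣ signedCount (colourRows μ u) -
      signedCount (colourRows μ fun a => if a ∈ X then none else u a) := by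
    intro X
    induction X using Finset.induction_on with
    | empty => simp
    | insert s X hs ih =>
      intro h0
      have hs0 : s ≠ 0 := by rintro rfl; simp at h0
      have hstep := card_dvd_signedCount_sub_update (s := s) (q := Pi.single 0 1)
        (x := colourRows μ fun a => if a ∈ X then none else u a)
        (y := fun i => shifted μ (none, i)) hs0
        (fun i => by simp [colourRows, shifted])
        (fun a ha c i j => by simp only [colourRows, ha, if_false, shifted_add])
        (fun c i j => shifted_add μ _ _ _ _)
        (fun a i => sum_shifted_pos hpos _) (fun i => sum_shifted_pos hpos _)
        (fun π => by
          have := hμ.isGenericFamily (L := fun k : Option G => k.elim (none, π.symm s) fun i =>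
            if π i = 0 then (none, 0) else (if π i ∈ X then none else u (π i), i)) (by
              rintro (_ | k) (_ | k') j i i' h h'
              · simp at h
              · simp at h
              · simp at h'
              · simp only [Option.elim] at h h'
                split_ifs at h h' <;> simp only [Prod.mk.injEq, reduceCtorEq, false_and] at h h'
                have := π.injective (hu (h.1.trans h'.1.symm))
                rw [← h.2, ← h'.2, this])
          convert this using 2 with k
          rcases k with _ | k <;> rfl)
      have hupd : Function.update (colourRows μ fun a => if a ∈ X then none else u a) s
          (fun i => shifted μ (none, i)) =
          colourRows μ fun a => if a ∈ insert s X then none else u a := by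
        ext a i z
        by_cases ha : a = s
        · subst ha
          simp [colourRows, hs0]
        · simp [ha, colourRows]
      rw [hupd] at hstep
      have := dvd_add (ih fun h => h0 (Finset.mem_insert_of_mem h)) hstep
      rwa [sub_add_sub_cancel] at this
  have h := key (Finset.univ.erase 0) (by simp)
  have hb : (colourRows μ fun a => if a ∈ Finset.univ.erase (0 : G) then none else u a) =
      fun a i : G => if a = 0 then (Pi.single 0 1 : G → ℝ) else Pi.single i 1 := by
    ext a i : 2
    by_cases ha : a = 0 <;> simp [colourRows, ha, shifted]
  rwa [hb, signedCount_basis] at h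

/-- If no selection of `|G|` colours from `t` contains the all-ones vector in its positive cone,
the signed counts of its subsets of size `|G| - 1` cancel. -/
lemma sum_signedCount_colourRows_eq_zero {μ : J → G → ℝ} (hpos : ∀ j, 0 < ∑ z, μ j z)
    (hμ : IsGenericOn μ Finset.univ) {t : G → J} (ht : Function.Injective t)
    (hno : ∀ π : Equiv.Perm G, ¬∃ l : G → ℝ, (∀ i, 0 < l i) ∧
      ∑ i, l i • shifted μ (some (t (π i)), i) = 1) :
    ∑ a, signedCount (colourRows μ fun b =>
      if b = 0 then none else some (t (Equiv.swap 0 a b))) = 0 := by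
  have h0 : signedCount (fun a i => shifted μ (some (t a), i)) = 0 :=
    Finset.sum_eq_zero fun π _ => if_neg (hno π)
  rw [signedCount_eq_sum_update (q := shifted μ (none, 0)) (fun a i => sum_shifted_pos hpos _)
    (sum_shifted_pos hpos _)] at h0
  · rw [← h0]
    refine Finset.sum_congr rfl fun a _ => ?_
    rw [← signedCount_comp_perm _ (Equiv.swap 0 a)]
    congr 1
    ext b i : 2
    by_cases hb : b = a
    · subst hb
      simp [colourRows]
    · have : Equiv.swap 0 a b ≠ 0 := fun h => hb (by
        rw [← Equiv.swap_apply_self 0 a b, h, Equiv.swap_apply_left])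
      simp [colourRows, hb, this]
  · intro π
    have := hμ.isGenericFamily (L := fun k : Option G => k.elim (none, 0) fun i =>
      (some (t (π i)), i)) (by
        rintro (_ | k) (_ | k') j i i' h h'
        · simp at h
        · simp at h
        · simp at h'
        · simp only [Option.elim, Prod.mk.injEq, Option.some.injEq] at h h'
          have := π.injective (ht (h.1.trans h'.1.symm))
          rw [← h.2, ← h'.2, this])
    convert this using 2 with k
    rcases k with _ | k <;> rfl

lemma exists_selection_of_isGenericOn (hG : (Fintype.card G).Prime)
    (hJ : Fintype.card J = 2 * Fintype.card G - 1) {μ : J → G → ℝ}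
    (hpos : ∀ j, 0 < ∑ z, μ j z) (hμ : IsGenericOn μ Finset.univ) :
    ∃ π : G → J, Function.Injective π ∧ ∃ l : G → ℝ, (∀ i, 0 < l i) ∧
      ∀ x, ∑ i, l i * μ (π i) (x - i) = 1 := by
  classical
  by_contra! hno
  have hG1 := hG.one_lt
  let f : Finset J → ℤ := fun S =>
    if h : ∃ u : G → Option J, Function.Injective u ∧ u 0 = none ∧
      Set.range u = (Finset.insertNone S : Set (Option J))
    then signedCount (colourRows μ h.choose) else 0
  have hf : ∀ (S : Finset J) (u : G → Option J), Function.Injective u → u 0 = none →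
      Set.range u = (Finset.insertNone S : Set (Option J)) →
      f S = signedCount (colourRows μ u) := by
    intro S u hu h0 hr
    have h : ∃ u : G → Option J, Function.Injective u ∧ u 0 = none ∧
      Set.range u = (Finset.insertNone S : Set (Option J)) := ⟨u, hu, h0, hr⟩
    simp only [f, dif_pos h]
    obtain ⟨h1, h2, h3⟩ := h.choose_spec
    exact signedCount_colourRows_eq_of_range_eq μ h1 hu (h2.trans h0.symm) (h3.trans hr.symm)
  have hsum : ∀ T : Finset J, T.card = Fintype.card G - 1 + 1 →
      ∑ t ∈ T, f (T.erase t) = 0 := by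
    intro T hT
    have hcard : Fintype.card G = Fintype.card T := by
      rw [Fintype.card_coe, hT]; omega
    let e := Fintype.equivOfCardEq hcard
    let t : G → J := fun a => e a
    have ht : Function.Injective t := Subtype.val_injective.comp e.injective
    have hz := sum_signedCount_colourRows_eq_zero hpos hμ ht (fun π ⟨l, hl, h⟩ => by
      obtain ⟨x, hx⟩ := hno (t ∘ π) (ht.comp π.injective) l hl
      refine hx ?_
      have := congrFun h x
      simpa [shifted] using this)
    rw [← Finset.sum_coe_sort, ← e.sum_comp, ← hz]
    refine Finset.sum_congr rfl fun a _ => hf _ _ ?_ (by simp) ?_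
    · intro b c hbc
      by_cases hb : b = 0 <;> by_cases hc : c = 0
      · rw [hb, hc]
      · simp [hb, hc] at hbc
      · simp [hb, hc] at hbc
      · simp only [hb, hc, if_false, Option.some.injEq] at hbc
        exact (Equiv.swap 0 a).injective (ht hbc)
    · ext o
      rcases o with _ | j
      · simp only [Set.mem_range, Finset.mem_coe, Finset.none_mem_insertNone, iff_true]
        exact ⟨0, by simp⟩
      · simp only [Set.mem_range, Finset.mem_coe, Finset.some_mem_insertNone, Finset.mem_erase]
        constructor
        · rintro ⟨b, hb⟩
          by_cases hb0 : b = 0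
          · simp [hb0] at hb
          · simp only [hb0, if_false, Option.some.injEq] at hb
            subst hb
            refine ⟨fun h => hb0 ?_, (e _).2⟩
            have := ht h
            rwa [Equiv.swap_apply_eq_iff, Equiv.swap_apply_right] at this
        · rintro ⟨hne, hj⟩
          have hte : t (e.symm ⟨j, hj⟩) = j := by simp [t]
          refine ⟨Equiv.swap 0 a (e.symm ⟨j, hj⟩), ?_⟩
          rw [if_neg, Equiv.swap_apply_self, hte]
          intro h
          rw [Equiv.swap_apply_eq_iff, Equiv.swap_apply_left] at h
          exact hne (by rw [← hte, h])
  obtain ⟨S₀, -, hS₀⟩ := Finset.exists_subset_card_eq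
    (s := (Finset.univ : Finset J)) (n := Fintype.card G - 1) (by rw [Finset.card_univ]; omega)
  have hzero := eq_zero_of_sum_erase_eq_zero (by omega) hsum hS₀
  obtain ⟨u, hu, hu0, hur⟩ := exists_injective_range_eq (G := G) (S := S₀) (by omega)
  have hdvd := card_dvd_signedCount_colourRows_sub hpos hμ hu
  rw [← hf S₀ u hu hu0 hur, hzero, zero_sub, dvd_neg, Int.natCast_dvd_natCast,
    hG.dvd_factorial] at hdvd
  omega

end Contradiction

section Closure

variable {J G : Type*} [Finite J] [AddCommGroup G] [Fintype G]

lemma isClosed_setOf_exists_selection :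
    IsClosed {μ : J → G → ℝ | ∃ π : G → J, Function.Injective π ∧ ∃ l ∈ stdSimplex ℝ G,
      ∀ x y, ∑ i, l i * μ (π i) (x - i) = ∑ i, l i * μ (π i) (y - i)} := by
  have heq : {μ : J → G → ℝ | ∃ π : G → J, Function.Injective π ∧ ∃ l ∈ stdSimplex ℝ G,
      ∀ x y, ∑ i, l i * μ (π i) (x - i) = ∑ i, l i * μ (π i) (y - i)} =
      ⋃ π : {π : G → J // Function.Injective π}, Prod.snd '' {q : stdSimplex ℝ G × (J → G → ℝ) |
        ∀ x y, ∑ i, q.1.1 i * q.2 (π.1 i) (x - i) = ∑ i, q.1.1 i * q.2 (π.1 i) (y - i)} := by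
    ext μ
    simp only [Set.mem_iUnion]
    constructor
    · rintro ⟨π, hπ, l, hl, h⟩
      exact ⟨⟨π, hπ⟩, (⟨l, hl⟩, μ), h, rfl⟩
    · rintro ⟨π, ⟨l, ν⟩, h, rfl⟩
      exact ⟨π.1, π.2, l.1, l.2, h⟩
  have hcont : ∀ (π : G → J) (x : G), Continuous fun q : stdSimplex ℝ G × (J → G → ℝ) =>
      ∑ i, q.1.1 i * q.2 (π i) (x - i) := fun π x =>
    continuous_finsetSum _ fun i _ =>
      ((continuous_apply i).comp (continuous_subtype_val.comp continuous_fst)).mul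
        ((continuous_apply _).comp ((continuous_apply _).comp continuous_snd))
  rw [heq]
  refine isClosed_iUnion_of_finite fun π => isClosedMap_snd_of_compactSpace _ ?_
  simp only [Set.ofPred_forall]
  exact isClosed_iInter fun x => isClosed_iInter fun y =>
    isClosed_eq (hcont π.1 x) (hcont π.1 y)

end Closure

/-- Fractional Erdős–Ginzburg–Ziv theorem: for a prime `p` and probability
measures `μ_1, …, μ_{2p-1}` on `ℤ/p`, there is an injection `π : ℤ/p → [2p-1]`
and convex coefficients `λ_i` such that `∑ λ_i (μ_{π(i)} + i)` is the uniform
probability measure on `ℤ/p`. -/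
theorem fractional_egz (p : ℕ) [Fact p.Prime] (μ : Fin (2 * p - 1) → ZMod p → ℝ)
    (hnonneg : ∀ j x, 0 ≤ μ j x) (hsum : ∀ j, ∑ x, μ j x = 1) :
    ∃ π : ZMod p → Fin (2 * p - 1), Function.Injective π ∧
      ∃ lam : ZMod p → ℝ, (∀ i, 0 ≤ lam i) ∧ (∑ i, lam i = 1) ∧
        ∀ x : ZMod p, ∑ i, lam i * μ (π i) (x - i) = 1 / p := by
  have hp : p.Prime := Fact.out
  suffices h : μ ∈ {μ : Fin (2 * p - 1) → ZMod p → ℝ | ∃ π : ZMod p → Fin (2 * p - 1),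
      Function.Injective π ∧ ∃ l ∈ stdSimplex ℝ (ZMod p),
      ∀ x y, ∑ i, l i * μ (π i) (x - i) = ∑ i, l i * μ (π i) (y - i)} by
    obtain ⟨π, hπ, l, hl, hxy⟩ := h
    refine ⟨π, hπ, l, hl.1, hl.2, fun x => ?_⟩
    have htot : ∑ y, ∑ i, l i * μ (π i) (y - i) = 1 := by
      rw [Finset.sum_comm, ← hl.2]
      refine Finset.sum_congr rfl fun i _ => ?_
      rw [← Finset.mul_sum, show ∑ y, μ (π i) (y - i) = ∑ y, μ (π i) y from
        (Equiv.subRight i).sum_comp _, hsum, mul_one]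
    rw [Finset.sum_congr rfl fun y _ => hxy y x, Finset.sum_const, Finset.card_univ, ZMod.card,
      nsmul_eq_mul] at htot
    have : (p : ℝ) ≠ 0 := by exact_mod_cast hp.ne_zero
    field_simp
    linarith
  by_contra hμ
  have hopen : IsOpen ({μ : Fin (2 * p - 1) → ZMod p → ℝ | ∃ π : ZMod p → Fin (2 * p - 1),
      Function.Injective π ∧ ∃ l ∈ stdSimplex ℝ (ZMod p),
      ∀ x y, ∑ i, l i * μ (π i) (x - i) = ∑ i, l i * μ (π i) (y - i)}ᶜ) :=
    isClosed_setOf_exists_selection.isOpen_compl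
  obtain ⟨U, hU, hsub⟩ := isOpen_pi_iff'.1 hopen μ hμ
  have hpos : IsOpen {ν : ZMod p → ℝ | 0 < ∑ z, ν z} :=
    isOpen_lt continuous_const (by fun_prop)
  obtain ⟨ν, hνU, hν⟩ := exists_isGenericOn
    (U := fun j => U j ∩ {ν : ZMod p → ℝ | 0 < ∑ z, ν z}) (fun j => (hU j).1.inter hpos)
    (fun j => ⟨μ j, (hU j).2, by simp [hsum]⟩) Finset.univ
  obtain ⟨π, hπ, l, hl, h⟩ := exists_selection_of_isGenericOn (by rwa [ZMod.card])
    (by simp) (fun j => (hνU j).2) hν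
  refine hsub (fun j _ => (hνU j).1) ⟨π, hπ, fun i => l i / ∑ k, l k, ?_, ?_⟩
  · have hL : 0 < ∑ k, l k := Finset.sum_pos (fun i _ => hl i) Finset.univ_nonempty
    exact ⟨fun i => div_nonneg (hl i).le hL.le, by rw [← Finset.sum_div, div_self hL.ne']⟩
  · intro x y
    simp only [div_mul_eq_mul_div, ← Finset.sum_div, h]
end

section
/- Let A = (a_{ij}) be an n × n real doubly stochastic matrix, i.e., all entries satisfy a_{ij} ≥ 0 and every row sum and every column sum equals 1. Then there exists a permutation π of {1, …, n} such that a_{i π(i)} > 0 for all i ∈ {1, …, n}. -/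
/-- Every doubly stochastic matrix has a positive diagonal: if `A` is an `n × n`
real matrix with nonnegative entries whose row and column sums all equal `1`,
then there is a permutation `π` with `A i (π i) > 0` for all `i`. -/
theorem doubly_stochastic_pos_diagonal (n : ℕ) (A : Fin n → Fin n → ℝ)
    (hnonneg : ∀ i j, 0 ≤ A i j)
    (hrow : ∀ i, ∑ j, A i j = 1) (hcol : ∀ j, ∑ i, A i j = 1) :
    ∃ π : Equiv.Perm (Fin n), ∀ i, 0 < A i (π i) := by
  obtain ⟨w, hw, hsum, hA⟩ := exists_eq_sum_perm_of_mem_doublyStochastic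
    (M := (Matrix.of A)) (mem_doublyStochastic_iff_sum.2 ⟨hnonneg, hrow, hcol⟩)
  obtain ⟨σ, -, hσ⟩ : ∃ σ ∈ Finset.univ, 0 < w σ :=
    (Finset.sum_pos_iff_of_nonneg fun σ _ => hw σ).1 (hsum ▸ one_pos)
  refine ⟨σ, fun i => ?_⟩
  have hi : A i (σ i) = ∑ τ : Equiv.Perm (Fin n), if τ i = σ i then w τ else 0 := by
    simpa [Matrix.sum_apply, Equiv.toPEquiv_apply, PEquiv.toMatrix_apply] using
      (congrFun (congrFun hA i) (σ i)).symm
  rw [hi]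
  refine Finset.sum_pos' (fun τ _ => ?_) ⟨σ, Finset.mem_univ σ, by simpa using hσ⟩
  split_ifs
  exacts [hw τ, le_rfl]
end

section
/- Let G be a group, let m ≥ 1, and let g, h : {1, …, m} → G be injective maps with the same image (i.e., {g_1, …, g_m} = {h_1, …, h_m} as sets). Define x_i = g_i^{-1} h_i for each i ∈ {1, …, m}. Then there exists a permutation π of {1, …, m} such that the ordered product x_{π(1)} · x_{π(2)} ⋯ x_{π(m)} = 1, the identity of G. -/
/-- The product of telescoping quotients along an iterated orbit. -/
theorem prod_map_range_iterate_inv_mul {α G : Type*} [Group G] (f : α → α) (g : α → G) (a : α)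
    (n : ℕ) :
    (((List.range n).map fun k => f^[k] a).map fun i => (g i)⁻¹ * g (f i)).prod =
      (g a)⁻¹ * g (f^[n] a) := by
  induction n with
  | zero => simp
  | succ n ih =>
    rw [List.range_succ, List.map_append, List.map_append, List.prod_append, ih]
    simp [Function.iterate_succ_apply', mul_assoc]

/-- For an injective self-map `f` of a finite type, the elements of an `f`-stable finite set can be
listed so that the product of the quotients `(g i)⁻¹ * g (f i)` is trivial. -/
theorem exists_nodup_list_prod_inv_mul_eq_one {α G : Type*} [Finite α] [Group G] {f : α → α}
    (hf : Function.Injective f) (g : α → G) (S : Finset α) (hS : ∀ x ∈ S, f x ∈ S) :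
    ∃ l : List α, l.Nodup ∧ (∀ x, x ∈ l ↔ x ∈ S) ∧
      (l.map fun i => (g i)⁻¹ * g (f i)).prod = 1 := by
  classical
  induction S using Finset.strongInduction with
  | H S ih =>
    obtain rfl | ⟨a, ha⟩ := S.eq_empty_or_nonempty
    · exact ⟨[], by simp⟩
    have hper : a ∈ Function.periodicPts f := hf.mem_periodicPts a
    have hpos := Function.minimalPeriod_pos_of_mem_periodicPts hper
    set p := Function.minimalPeriod f a with hp
    set o : List α := (List.range p).map fun k => f^[k] a with ho
    have hnodup : o.Nodup := Function.nodup_periodicOrbit (f := f) (x := a)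
    have hmem (x : α) : x ∈ o ↔ ∃ n, f^[n] a = x := Function.mem_periodicOrbit_iff hper
    have hao : a ∈ o := (hmem a).2 ⟨0, rfl⟩
    have hiter (n : ℕ) : f^[n] a ∈ S := by
      induction n with
      | zero => exact ha
      | succ n ihn => rw [Function.iterate_succ_apply']; exact hS _ ihn
    have hback (x : α) (hx : f x ∈ o) : x ∈ o := by
      obtain ⟨n, hn⟩ := (hmem _).1 hx
      refine (hmem _).2 ⟨n + (p - 1), hf ?_⟩
      rw [← Function.iterate_succ_apply' f, ← hn, Nat.succ_eq_add_one,
        show n + (p - 1) + 1 = n + p by omega, Function.iterate_add_apply,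
        Function.iterate_minimalPeriod]
    have hoS (x : α) (hx : x ∈ o) : x ∈ S := by
      obtain ⟨n, rfl⟩ := (hmem x).1 hx
      exact hiter n
    obtain ⟨l, hl, hlmem, hlprod⟩ := ih (S \ o.toFinset)
      (Finset.sdiff_ssubset (fun x hx => hoS x (List.mem_toFinset.1 hx))
        ⟨a, List.mem_toFinset.2 hao⟩)
      (fun x hx => by
        simp only [Finset.mem_sdiff, List.mem_toFinset] at hx ⊢
        exact ⟨hS x hx.1, fun h => hx.2 (hback x h)⟩)
    refine ⟨o ++ l, ?_, fun x => ?_, ?_⟩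
    · refine hnodup.append hl fun x hx hxl => ?_
      simpa [hx] using (hlmem x).1 hxl
    · rw [List.mem_append, hlmem, Finset.mem_sdiff, List.mem_toFinset]
      have := hoS x
      tauto
    · rw [List.map_append, List.prod_append, hlprod, ho, prod_map_range_iterate_inv_mul,
        hp, Function.iterate_minimalPeriod]
      simp

/-- If `g, h : [m] → G` are injective with the same image, then the quotients
`x_i = g_i⁻¹ h_i` can be ordered so that their product is the identity. -/
theorem perm_product_one (G : Type*) [Group G] (m : ℕ) (hm : 1 ≤ m)
    (g h : Fin m → G) (hg : Function.Injective g) (hh : Function.Injective h)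
    (hgh : Set.range g = Set.range h) :
    ∃ π : Equiv.Perm (Fin m),
      (List.ofFn (fun i : Fin m => (g (π i))⁻¹ * h (π i))).prod = 1 := by
  have hex (i : Fin m) : ∃ j, g j = h i := by
    have : h i ∈ Set.range g := hgh ▸ Set.mem_range_self i
    exact this
  choose f hf using hex
  have hfinj : Function.Injective f := fun i j hij => hh (by rw [← hf, ← hf, hij])
  obtain ⟨l, hl, hmem, hprod⟩ :=
    exists_nodup_list_prod_inv_mul_eq_one hfinj g Finset.univ (by simp)
  let e : Fin l.length ≃ Fin m :=
    hl.getEquivOfForallMemList l fun x => (hmem x).2 (Finset.mem_univ x)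
  have hlen : l.length = m := by simpa using Fintype.card_congr e
  refine ⟨(finCongr hlen.symm).trans e, ?_⟩
  rw [← hprod]
  congr 1
  refine List.ext_getElem (by simp [hlen]) fun i _ _ => ?_
  simp [e, hf]
end

section
/- Let p ≥ 2 be a prime and let a_1, a_2, …, a_{p−1} be a sequence of p−1 elements of ℤ/p. Then there exist pairwise distinct elements b_1, b_2, …, b_{p−1} ∈ ℤ/p such that {a_1 + b_1, a_2 + b_2, …, a_{p−1} + b_{p−1}} = {0, 1, …, p−2}; that is, the map i ↦ a_i + b_i is injective and its image is the complement of the residue class of p−1 (equivalently, of −1) in ℤ/p. -/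
open Finset Equiv

/-- In a field with `q` elements, `∑ x ^ (q - 1) = -1`. -/
lemma FiniteField.sum_pow_card_sub_one (K : Type*) [Field K] [Fintype K] :
    ∑ x : K, x ^ (Fintype.card K - 1) = -1 := by
  classical
  have hq : Fintype.card K - 1 ≠ 0 := by
    have := Fintype.one_lt_card (α := K)
    omega
  have h (x : K) : x ^ (Fintype.card K - 1) = 1 - if x = 0 then 1 else 0 := by
    split_ifs with hx
    · simp [hx, hq]
    · simp [FiniteField.pow_card_sub_one_eq_one x hx]
  simp [h, Finset.sum_sub_distrib]

/-- Summing `x ^ (r + 1) * (x + d) ^ s` over a field with `q` elements extracts the coefficient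
of `x ^ (q - 1)`, provided the degree is at most `q - 1`. -/
lemma FiniteField.sum_pow_succ_mul_add_pow {K : Type*} [Field K] [Fintype K] (d : K) {r s : ℕ}
    (h : r + s + 1 ≤ Fintype.card K - 1) :
    ∑ x : K, x ^ (r + 1) * (x + d) ^ s = if r + s + 1 = Fintype.card K - 1 then -1 else 0 := by
  simp_rw [add_pow, Finset.mul_sum]
  rw [Finset.sum_comm, Finset.sum_range_succ, Finset.sum_eq_zero, zero_add]
  · simp only [Nat.sub_self, pow_zero, mul_one, Nat.choose_self, Nat.cast_one, ← pow_add]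
    rw [show r + 1 + s = r + s + 1 by ring]
    split_ifs with heq
    · rw [heq, FiniteField.sum_pow_card_sub_one]
    · exact FiniteField.sum_pow_lt_card_sub_one K _ (by omega)
  · intro m hm
    have hm := Finset.mem_range.1 hm
    simp_rw [← mul_assoc, ← pow_add, mul_assoc]
    rw [← Finset.sum_mul, FiniteField.sum_pow_lt_card_sub_one K _ (by omega), zero_mul]

/-- If `σ i + τ i ≥ n - 1` for all `i`, then `τ` is the reversal of `σ`. -/
lemma eq_revPerm_mul_of_le_add {n : ℕ} {σ τ : Perm (Fin n)}
    (h : ∀ i, n ≤ (σ i : ℕ) + τ i + 1) : τ = Fin.revPerm * σ := by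
  have hle (i : Fin n) : ((Fin.revPerm * σ : Perm (Fin n)) i : ℕ) ≤ τ i := by
    have := h i
    simp only [Perm.mul_apply, Fin.revPerm_apply, Fin.val_rev]
    omega
  have hsum : ∑ i, ((Fin.revPerm * σ : Perm (Fin n)) i : ℕ) = ∑ i, (τ i : ℕ) := by
    rw [Equiv.sum_comp (Fin.revPerm * σ) (fun j : Fin n => (j : ℕ)),
      Equiv.sum_comp τ (fun j : Fin n => (j : ℕ))]
  ext i
  exact ((Finset.sum_eq_sum_iff_of_le fun i _ => hle i).1 hsum i (mem_univ i)).symm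

/-- A weighted sum of products of two Vandermonde determinants over a field with `n + 1`
elements. -/
lemma sum_prod_mul_det_vandermonde_mul_det_vandermonde_add {K : Type*} [Field K] [Fintype K]
    {n : ℕ} (hn : n = Fintype.card K - 1) (d : Fin n → K) :
    ∑ x : Fin n → K, (∏ i, x i) *
        ((Matrix.vandermonde x).det * (Matrix.vandermonde (x + d)).det) =
      n.factorial * ((Perm.sign (Fin.revPerm (n := n)) : ℤ) * (-1) ^ n) := by
  have hdet (v : Fin n → K) : (Matrix.vandermonde v).det =
      ∑ σ : Perm (Fin n), ((Perm.sign σ : ℤ) : K) * ∏ i, v i ^ (σ i : ℕ) := by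
    rw [← Matrix.det_transpose, Matrix.det_apply']
    rfl
  have hexpand (x : Fin n → K) : (∏ i, x i) *
        ((Matrix.vandermonde x).det * (Matrix.vandermonde (x + d)).det) =
      ∑ σ : Perm (Fin n), ∑ τ : Perm (Fin n), ((Perm.sign σ : ℤ) : K) * ((Perm.sign τ : ℤ) : K) *
        ∏ i, (x i ^ ((σ i : ℕ) + 1) * (x i + d i) ^ (τ i : ℕ)) := by
    simp_rw [hdet, Finset.sum_mul_sum, Finset.mul_sum, pow_succ, Finset.prod_mul_distrib,
      Pi.add_apply]
    refine Finset.sum_congr rfl fun σ _ => Finset.sum_congr rfl fun τ _ => ?_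
    ring
  simp_rw [hexpand]
  rw [Finset.sum_comm]
  have hσ (σ : Perm (Fin n)) : ∑ x : Fin n → K, ∑ τ : Perm (Fin n),
      ((Perm.sign σ : ℤ) : K) * ((Perm.sign τ : ℤ) : K) *
        ∏ i, (x i ^ ((σ i : ℕ) + 1) * (x i + d i) ^ (τ i : ℕ)) =
      (Perm.sign (Fin.revPerm (n := n)) : ℤ) * (-1) ^ n := by
    rw [Finset.sum_comm]
    have hfactor (τ : Perm (Fin n)) :
        ∑ x : Fin n → K, ∏ i, (x i ^ ((σ i : ℕ) + 1) * (x i + d i) ^ (τ i : ℕ)) =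
          ∏ i, ∑ y : K, y ^ ((σ i : ℕ) + 1) * (y + d i) ^ (τ i : ℕ) :=
      (Fintype.prod_sum fun i (y : K) => y ^ ((σ i : ℕ) + 1) * (y + d i) ^ (τ i : ℕ)).symm
    simp_rw [← Finset.mul_sum, hfactor]
    rw [Finset.sum_eq_single (Fin.revPerm * σ)]
    · have hi (i : Fin n) : ∑ y : K, y ^ ((σ i : ℕ) + 1) *
          (y + d i) ^ ((Fin.revPerm * σ : Perm (Fin n)) i : ℕ) = -1 := by
        have heq : (σ i : ℕ) + ((Fin.revPerm * σ : Perm (Fin n)) i : ℕ) + 1 =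
            Fintype.card K - 1 := by
          have := (σ i).isLt
          simp only [Perm.mul_apply, Fin.revPerm_apply, Fin.val_rev]
          omega
        rw [FiniteField.sum_pow_succ_mul_add_pow _ heq.le, if_pos heq]
      have hsq : ((Perm.sign σ : ℤ) : K) * ((Perm.sign σ : ℤ) : K) = 1 := by
        rw [← Int.cast_mul, Int.units_coe_mul_self, Int.cast_one]
      simp_rw [hi]
      rw [Perm.sign_mul, Finset.prod_const, Finset.card_univ, Fintype.card_fin]
      push_cast
      linear_combination ((Perm.sign (Fin.revPerm (n := n)) : ℤ) : K) * (-1) ^ n * hsq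
    · intro τ _ hτ
      obtain ⟨i, hi⟩ : ∃ i, (σ i : ℕ) + τ i + 1 < n := by
        by_contra! h
        exact hτ (eq_revPerm_mul_of_le_add h)
      rw [Finset.prod_eq_zero (mem_univ i), mul_zero]
      rw [FiniteField.sum_pow_succ_mul_add_pow _ (by omega), if_neg (by omega)]
    · simp
  simp_rw [hσ]
  simp [Fintype.card_perm]

/-- For any shift vector `d` there is an enumeration `x` of the nonzero elements of `ℤ/p` such that
`x + d` also has pairwise distinct entries. -/
lemma ZMod.exists_injective_add_injective (p : ℕ) [Fact p.Prime] (d : Fin (p - 1) → ZMod p) :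
    ∃ x : Fin (p - 1) → ZMod p, (∀ i, x i ≠ 0) ∧ Function.Injective x ∧
      Function.Injective (x + d) := by
  have hp : p.Prime := Fact.out
  have hfac : ((p - 1).factorial : ZMod p) ≠ 0 := by
    rw [Ne, ZMod.natCast_eq_zero_iff, hp.dvd_factorial]
    have := hp.pos
    omega
  have hsign : ((Perm.sign (Fin.revPerm (n := p - 1)) : ℤ) : ZMod p) ≠ 0 := by
    rcases Int.units_eq_one_or (Perm.sign (Fin.revPerm (n := p - 1))) with h | h <;> simp [h]
  have hne : ∑ x : Fin (p - 1) → ZMod p, (∏ i, x i) *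
      ((Matrix.vandermonde x).det * (Matrix.vandermonde (x + d)).det) ≠ 0 := by
    rw [sum_prod_mul_det_vandermonde_mul_det_vandermonde_add (by rw [ZMod.card])]
    exact mul_ne_zero hfac (mul_ne_zero hsign (pow_ne_zero _ (neg_ne_zero.2 one_ne_zero)))
  obtain ⟨x, -, hx⟩ := Finset.exists_ne_zero_of_sum_ne_zero hne
  have hdets := mul_ne_zero_iff.1 (right_ne_zero_of_mul hx)
  exact ⟨x, fun i => Finset.prod_ne_zero_iff.1 (left_ne_zero_of_mul hx) i (mem_univ i),
    Matrix.det_vandermonde_ne_zero_iff.1 hdets.1, Matrix.det_vandermonde_ne_zero_iff.1 hdets.2⟩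

/-- Partial transversals: for a prime `p` and a sequence `a_1, …, a_{p-1}` in
`ℤ/p`, there are pairwise distinct `b_1, …, b_{p-1} ∈ ℤ/p` with
`{a_i + b_i} = {0, 1, …, p-2} = ℤ/p \ {-1}`. -/
theorem partial_transversal (p : ℕ) [Fact p.Prime] (a : Fin (p - 1) → ZMod p) :
    ∃ b : Fin (p - 1) → ZMod p, Function.Injective b ∧
      Function.Injective (fun i => a i + b i) ∧
      Finset.univ.image (fun i => a i + b i) = Finset.univ.erase (-1 : ZMod p) := by
  obtain ⟨x, hx0, hx, hxa⟩ := ZMod.exists_injective_add_injective p (-a)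
  have hinj : Function.Injective fun i => a i + (x i - a i - 1) := by
    intro i j h
    exact hx (by linear_combination h)
  refine ⟨fun i => x i - a i - 1, fun i j h => hxa ?_, hinj, ?_⟩
  · simp only [Pi.add_apply, Pi.neg_apply]
    linear_combination h
  · refine Finset.eq_of_subset_of_card_le (fun y hy => ?_) ?_
    · obtain ⟨i, -, rfl⟩ := Finset.mem_image.1 hy
      refine Finset.mem_erase.2 ⟨fun h => hx0 i ?_, mem_univ _⟩
      linear_combination h
    · rw [Finset.card_image_of_injective _ hinj, Finset.card_erase_of_mem (mem_univ _)]
      simp [ZMod.card]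
end

section
/- Let n ≥ 2 be an integer and let f : ℤ/n × {1, …, 2n−1} → ℤ/n be a map that is ℤ/n-equivariant in the sense that f(i + j, k) = f(i, k) + j for all i, j ∈ ℤ/n and all k ∈ {1, …, 2n−1} (equivalently, f(i,k) = f(0,k) + i). Then there exists an injective map π : ℤ/n → {1, …, 2n−1} such that the map i ↦ f(i, π(i)) is a bijection of ℤ/n. -/
/-- If two points lie on a common cycle of a permutation, then composing with their transposition
separates them. -/
theorem Equiv.Perm.SameCycle.not_sameCycle_swap_mul {α : Type*} [Finite α] [DecidableEq α]
    {σ : Equiv.Perm α} {a b : α} (hab : a ≠ b) (h : σ.SameCycle b a) :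
    ¬ (Equiv.swap a b * σ).SameCycle b a := by
  classical
  have hex := h.exists_nat_pow_eq
  set m := Nat.find hex
  have hm : (σ ^ m) b = a := Nat.find_spec hex
  have hmin : ∀ k < m, (σ ^ k) b ≠ a := fun k hk => Nat.find_min hex hk
  have hpos : 0 < m := by
    rcases Nat.eq_zero_or_pos m with h0 | h0
    · rw [h0] at hm
      exact absurd hm.symm (by simpa using hab)
    · exact h0
  have key : ∀ i : ℕ, ∃ k < m, ((Equiv.swap a b * σ) ^ i) b = (σ ^ k) b := by
    intro i
    induction i with
    | zero => exact ⟨0, hpos, by simp⟩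
    | succ i ih =>
      obtain ⟨k, hk, hki⟩ := ih
      have hstep : ((Equiv.swap a b * σ) ^ (i + 1)) b = Equiv.swap a b ((σ ^ (k + 1)) b) := by
        rw [pow_succ', Equiv.Perm.mul_apply, hki, pow_succ' σ, Equiv.Perm.mul_apply,
          Equiv.Perm.mul_apply]
      rcases Nat.lt_or_ge (k + 1) m with hlt | hge
      · refine ⟨k + 1, hlt, ?_⟩
        rw [hstep]
        refine Equiv.swap_apply_of_ne_of_ne (hmin _ hlt) fun hb => ?_
        refine hmin (m - (k + 1)) (by omega) ?_
        have hsplit : m = (m - (k + 1)) + (k + 1) := by omega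
        rw [hsplit, pow_add, Equiv.Perm.mul_apply, hb] at hm
        exact hm
      · have hkm : k + 1 = m := by omega
        refine ⟨0, hpos, ?_⟩
        rw [hstep, hkm, hm]
        simp
  intro hs
  obtain ⟨i, hi⟩ := hs.exists_nat_pow_eq
  obtain ⟨k, hk, hki⟩ := key i
  exact hmin k hk (hki.symm.trans hi)

/-- The difference at `a` of two bijections `ι ≃ G` can be prescribed without changing the
differences outside `{a, b}`, provided that `a` and `b` are on different cycles of
`j ↦ y⁻¹ (x a + x b + t - x j)`. -/
theorem exists_equiv_sub_eq_of_not_sameCycle {ι G : Type*} [AddCommGroup G] {a b : ι}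
    (x y : ι ≃ G) (t : G)
    (h : ¬ Equiv.Perm.SameCycle ((x.trans (Equiv.subLeft (x a + x b + t))).trans y.symm) b a) :
    ∃ x' y' : ι ≃ G, (∀ i, i ≠ a → i ≠ b → y' i - x' i = y i - x i) ∧ y' a - x' a = t := by
  classical
  set ρ : Equiv.Perm ι := (x.trans (Equiv.subLeft (x a + x b + t))).trans y.symm with hρ
  have hy : ∀ i, y (ρ i) = x a + x b + t - x i := fun i => by simp [hρ]
  have hca : ρ.cycleOf b a = a := Equiv.Perm.cycleOf_apply_of_not_sameCycle h
  refine ⟨(ρ.cycleOf b).symm.trans x, ((Equiv.swap a b).trans (ρ.cycleOf b)).trans y, ?_, ?_⟩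
  · intro i hia hib
    simp only [Equiv.trans_apply, Equiv.swap_apply_of_ne_of_ne hia hib]
    by_cases hi : ρ.SameCycle b i
    · have hinv : (ρ.cycleOf b).symm i = ρ.symm i := by
        rw [Equiv.symm_apply_eq,
          Equiv.Perm.SameCycle.cycleOf_apply (Equiv.Perm.sameCycle_symm_apply_right.2 hi)]
        exact (ρ.apply_symm_apply i).symm
      have hyi : y i = x a + x b + t - x (ρ.symm i) := by rw [← hy]; simp
      rw [hi.cycleOf_apply, hinv, hy, hyi]
      abel
    · have hfix : ρ.cycleOf b i = i := Equiv.Perm.cycleOf_apply_of_not_sameCycle hi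
      rw [hfix, (Equiv.symm_apply_eq _).2 hfix.symm]
  · simp only [Equiv.trans_apply, Equiv.swap_apply_left]
    rw [(Equiv.symm_apply_eq _).2 hca.symm, Equiv.Perm.cycleOf_apply_self, hy]
    abel

/-- The difference at `a` of two bijections `ι ≃ G` can be prescribed at the cost of changing only
one further difference. -/
theorem exists_equiv_sub_eq {ι G : Type*} [Finite ι] [AddCommGroup G] {a b : ι} (hab : a ≠ b)
    (x y : ι ≃ G) (t : G) :
    ∃ x' y' : ι ≃ G, (∀ i, i ≠ a → i ≠ b → y' i - x' i = y i - x i) ∧ y' a - x' a = t := by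
  classical
  by_cases h : Equiv.Perm.SameCycle ((x.trans (Equiv.subLeft (x a + x b + t))).trans y.symm) b a
  · obtain ⟨x', y', h₁, h₂⟩ := exists_equiv_sub_eq_of_not_sameCycle x ((Equiv.swap a b).trans y) t
      (h.not_sameCycle_swap_mul hab)
    refine ⟨x', y', fun i hia hib => ?_, h₂⟩
    rw [h₁ i hia hib, Equiv.trans_apply, Equiv.swap_apply_of_ne_of_ne hia hib]
  · exact exists_equiv_sub_eq_of_not_sameCycle x y t h

/-- **Hall's theorem**: a family of elements of a finite abelian group, indexed by a type of the
same cardinality, is a difference of two bijections if its sum vanishes. -/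
theorem exists_equiv_sub_eq_of_sum_eq_zero {ι G : Type*} [Fintype ι] [AddCommGroup G]
    (e : ι ≃ G) (d : ι → G) (hd : ∑ i, d i = 0) :
    ∃ x y : ι ≃ G, ∀ i, y i - x i = d i := by
  classical
  let b := e.symm 0
  have key : ∀ s : Finset ι, b ∉ s → ∃ x y : ι ≃ G, ∀ i ∈ s, y i - x i = d i := by
    intro s
    induction s using Finset.induction_on with
    | empty => exact fun _ => ⟨e, e, by simp⟩
    | insert a s has ih =>
      intro hb
      rw [Finset.mem_insert, not_or] at hb
      obtain ⟨x, y, hxy⟩ := ih hb.2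
      obtain ⟨x', y', h₁, h₂⟩ := exists_equiv_sub_eq (Ne.symm hb.1) x y (d a)
      refine ⟨x', y', fun i hi => ?_⟩
      rcases Finset.mem_insert.1 hi with rfl | his
      · exact h₂
      · rw [h₁ i (fun hia => has (hia ▸ his)) (fun hib => hb.2 (hib ▸ his)), hxy i his]
  obtain ⟨x, y, hxy⟩ := key (Finset.univ.erase b) (by simp)
  refine ⟨x, y, fun i => ?_⟩
  by_cases hi : i = b
  · have hsum : ∑ j, (y j - x j) = ∑ j, d j := by
      rw [hd, Finset.sum_sub_distrib, sub_eq_zero]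
      exact Fintype.sum_equiv (y.trans x.symm) _ _ (by simp)
    rw [← Finset.add_sum_erase _ _ (Finset.mem_univ b),
      ← Finset.add_sum_erase _ d (Finset.mem_univ b), Finset.sum_congr rfl hxy] at hsum
    rw [hi]
    exact add_right_cancel hsum
  · exact hxy i (by simp [hi])

/-- Surjectivity of equivariant simplicial maps from the chessboard complex:
if `f : ℤ/n × [2n-1] → ℤ/n` satisfies `f(i+j, k) = f(i,k) + j`, then there is an
injection `π : ℤ/n → [2n-1]` such that `i ↦ f(i, π i)` is a bijection of `ℤ/n`. -/
theorem equivariant_chessboard_surjective (n : ℕ) (hn : 2 ≤ n)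
    (f : ZMod n × Fin (2 * n - 1) → ZMod n)
    (hf : ∀ (i j : ZMod n) (k : Fin (2 * n - 1)), f (i + j, k) = f (i, k) + j) :
    ∃ π : ZMod n → Fin (2 * n - 1), Function.Injective π ∧
      Function.Bijective (fun i : ZMod n => f (i, π i)) := by
  have : NeZero n := ⟨by omega⟩
  obtain ⟨t, -, htcard, htsum⟩ := ZMod.erdos_ginzburg_ziv (s := Finset.univ)
    (fun k : Fin (2 * n - 1) => f (0, k)) (by simp)
  have e : t ≃ ZMod n := Fintype.equivOfCardEq (by simp [htcard, ZMod.card])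
  obtain ⟨x, y, hxy⟩ := exists_equiv_sub_eq_of_sum_eq_zero e (fun k => f (0, k))
    ((Finset.sum_coe_sort t fun k => f (0, k)).trans htsum)
  refine ⟨fun i => x.symm i, Subtype.val_injective.comp x.symm.injective, ?_⟩
  have hfun : (fun i : ZMod n => f (i, x.symm i)) = x.symm.trans y := by
    funext i
    have hshift := hf 0 i (x.symm i)
    rw [zero_add, ← hxy (x.symm i)] at hshift
    simpa using hshift
  rw [hfun]
  exact (x.symm.trans y).bijective
end

section
/- Let n ≥ 2 be an integer and let a_1, …, a_{2n−1} be a sequence of elements of ℤ/n. Then there exist indices 1 ≤ i_1 < i_2 < ⋯ < i_n ≤ 2n−1 and two bijections b, c : {1, …, n} → ℤ/n (two orderings b_1, …, b_n and c_1, …, c_n of all elements of ℤ/n) such that a_{i_j} = b_j − c_j for every j ∈ {1, …, n}. -/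
open Equiv in
/-- If `x` and `y` are distinct, then they lie in different cycles of `σ` or of
`swap x y * σ`. -/
theorem Equiv.Perm.not_sameCycle_or_not_sameCycle_swap_mul {α : Type*} [Finite α]
    [DecidableEq α] (σ : Perm α) {x y : α} (hxy : x ≠ y) :
    ¬ σ.SameCycle x y ∨ ¬ (swap x y * σ).SameCycle x y := by
  classical
  by_cases hσ : σ.SameCycle x y
  swap
  · exact Or.inl hσ
  right
  obtain ⟨m, hm⟩ : ∃ m : ℕ, (σ ^ m) x = y := by
    obtain ⟨m, -, hm⟩ := hσ.exists_pow_eq'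
    exact ⟨m, hm⟩
  have hex : ∃ m : ℕ, 0 < m ∧ ((σ ^ m) x = x ∨ (σ ^ m) x = y) := by
    refine ⟨m, Nat.pos_of_ne_zero ?_, Or.inr hm⟩
    rintro rfl
    exact hxy (by simpa using hm)
  obtain ⟨hN, hNx⟩ := Nat.find_spec hex
  have hmin : ∀ t < Nat.find hex, 0 < t → (σ ^ t) x ≠ x ∧ (σ ^ t) x ≠ y := by
    intro t ht h0
    have := Nat.find_min hex ht
    tauto
  set N := Nat.find hex
  have hNy : (σ ^ N) x = y := by
    refine hNx.resolve_left fun h => ?_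
    have hper : (σ ^ (m % N)) x = y := by
      rw [← hm]
      conv_rhs => rw [← Nat.mod_add_div m N, pow_add, pow_mul, Perm.mul_apply,
        Perm.pow_apply_eq_self_of_apply_eq_self h]
    rcases Nat.eq_zero_or_pos (m % N) with h0 | h0
    · rw [h0] at hper
      exact hxy (by simpa using hper)
    · exact (hmin _ (Nat.mod_lt _ hN) h0).2 hper
  have hpow : ∀ t < N, ((swap x y * σ) ^ t) x = (σ ^ t) x := by
    intro t
    induction t with
    | zero => simp
    | succ t ih =>
      intro ht
      obtain ⟨h1, h2⟩ := hmin (t + 1) ht t.succ_pos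
      rw [pow_succ', Perm.mul_apply, ih (by omega), Perm.mul_apply, ← Perm.mul_apply σ,
        ← pow_succ', swap_apply_of_ne_of_ne h1 h2]
  have hret : ((swap x y * σ) ^ N) x = x := by
    obtain ⟨k, hk⟩ : ∃ k, N = k + 1 := ⟨N - 1, by omega⟩
    rw [hk, pow_succ', Perm.mul_apply, hpow k (by omega), Perm.mul_apply, ← Perm.mul_apply σ,
      ← pow_succ', ← hk, hNy, swap_apply_right]
  intro h
  obtain ⟨t, -, ht⟩ := h.exists_pow_eq'
  rw [← Nat.mod_add_div t N, pow_add, pow_mul, Perm.mul_apply,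
    Perm.pow_apply_eq_self_of_apply_eq_self hret, hpow _ (Nat.mod_lt _ hN)] at ht
  rcases Nat.eq_zero_or_pos (t % N) with h0 | h0
  · rw [h0] at ht
    exact hxy (by simpa using ht)
  · exact (hmin _ (Nat.mod_lt _ hN) h0).2 ht

/-- The difference of two bijections onto a finite abelian group can be given any prescribed value
at `i` by changing it only at `i` and at one other index `j`. -/
theorem Equiv.exists_sub_eq_of_ne {ι G : Type*} [Finite ι] [AddCommGroup G]
    (b c : ι ≃ G) {i j : ι} (hij : i ≠ j) (v : G) :
    ∃ b' c' : ι ≃ G, b' i - c' i = v ∧ ∀ k, k ≠ i → k ≠ j → b' k - c' k = b k - c k := by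
  classical
  have key : ∀ (d : ι ≃ G) (τ : Perm ι), (∀ k, b k + d (τ k) = b i + b j - v) →
      ¬ τ.SameCycle j i → ∃ b' c' : ι ≃ G, b' i - c' i = v ∧
        ∀ k, k ≠ i → k ≠ j → b' k - c' k = b k - d k := by
    intro d τ hτ hji
    refine ⟨(τ.cycleOf j)⁻¹.trans b, ((swap i j).trans (τ.cycleOf j)).trans d, ?_, ?_⟩
    · have h1 : (τ.cycleOf j)⁻¹ i = i := by
        rw [Perm.inv_eq_iff_eq, Perm.cycleOf_apply_of_not_sameCycle hji]
      have h2 := hτ j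
      simp only [trans_apply, swap_apply_left, Perm.cycleOf_apply_self, h1]
      rw [eq_sub_of_add_eq' h2]
      abel
    · intro k hki hkj
      simp only [trans_apply, swap_apply_of_ne_of_ne hki hkj]
      by_cases hk : τ.SameCycle j k
      · have h1 : (τ.cycleOf j)⁻¹ k = τ⁻¹ k := by
          rw [Perm.inv_eq_iff_eq, Perm.SameCycle.cycleOf_apply (by simpa using hk)]
          simp
        have h2 := hτ (τ⁻¹ k)
        rw [← Perm.mul_apply, mul_inv_cancel, Perm.one_apply] at h2
        rw [h1, hk.cycleOf_apply, eq_sub_of_add_eq h2, eq_sub_of_add_eq' (hτ k)]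
        abel
      · have h1 : (τ.cycleOf j)⁻¹ k = k := by
          rw [Perm.inv_eq_iff_eq, Perm.cycleOf_apply_of_not_sameCycle hk]
        rw [h1, Perm.cycleOf_apply_of_not_sameCycle hk]
  let σ : Perm ι := (b.trans (Equiv.subLeft (b i + b j - v))).trans c.symm
  have hσ : ∀ k, b k + c (σ k) = b i + b j - v := fun k => by simp [σ]
  rcases σ.not_sameCycle_or_not_sameCycle_swap_mul hij.symm with h | h
  · exact key c σ hσ h
  · obtain ⟨b', c', h1, h2⟩ := key ((swap j i).trans c) (swap j i * σ) (by simpa using hσ) h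
    refine ⟨b', c', h1, fun k hki hkj => ?_⟩
    rw [h2 k hki hkj, trans_apply, swap_apply_of_ne_of_ne hkj hki]

/-- **Hall's theorem** on differences of permutations: a family of elements of a finite abelian
group, indexed by a type of the same cardinality as the group, is the difference of two bijections
as soon as its sum is zero. -/
theorem Fintype.exists_equiv_sub_eq_of_sum_eq_zero {ι G : Type*} [Fintype ι] [Fintype G]
    [AddCommGroup G] (hcard : Fintype.card ι = Fintype.card G) (a : ι → G)
    (ha : ∑ k, a k = 0) : ∃ b c : ι ≃ G, ∀ k, a k = b k - c k := by
  classical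
  let e : ι ≃ G := Fintype.equivOfCardEq hcard
  let j : ι := e.symm 0
  have partial_sub : ∀ s : Finset ι, j ∉ s → ∃ b c : ι ≃ G, ∀ k ∈ s, b k - c k = a k := by
    intro s
    induction s using Finset.induction_on with
    | empty => exact fun _ => ⟨e, e, by simp⟩
    | insert i s his ih =>
      intro hj
      rw [Finset.mem_insert, not_or] at hj
      obtain ⟨b, c, hbc⟩ := ih hj.2
      obtain ⟨b', c', hi, hk⟩ := Equiv.exists_sub_eq_of_ne b c (Ne.symm hj.1) (a i)
      refine ⟨b', c', fun k hks => ?_⟩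
      rcases Finset.mem_insert.1 hks with rfl | hks
      · exact hi
      · rw [hk k (ne_of_mem_of_not_mem hks his) (ne_of_mem_of_not_mem hks hj.2), hbc k hks]
  obtain ⟨b, c, hbc⟩ := partial_sub (Finset.univ.erase j) (Finset.notMem_erase _ _)
  refine ⟨b, c, fun k => ?_⟩
  by_cases hkj : k = j
  · rw [hkj]
    have hsum : ∑ k, (b k - c k) = 0 := by
      rw [Finset.sum_sub_distrib, Equiv.sum_comp b (fun x => x), Equiv.sum_comp c (fun x => x),
        sub_self]
    rw [← Finset.add_sum_erase _ _ (Finset.mem_univ j)] at ha hsum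
    rw [Finset.sum_congr rfl hbc] at hsum
    exact add_right_cancel (ha.trans hsum.symm)
  · exact (hbc k (by simp [hkj])).symm

/-- Reformulated Erdős–Ginzburg–Ziv theorem: any sequence of `2n-1` elements of
`ℤ/n` contains a subsequence of length `n` that is the termwise difference of two
orderings of all elements of `ℤ/n`. -/
theorem egz_difference_of_permutations (n : ℕ) (hn : 2 ≤ n)
    (a : Fin (2 * n - 1) → ZMod n) :
    ∃ i : Fin n → Fin (2 * n - 1), StrictMono i ∧
      ∃ b c : Fin n → ZMod n, Function.Bijective b ∧ Function.Bijective c ∧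
        ∀ j, a (i j) = b j - c j := by
  have : NeZero n := ⟨by omega⟩
  obtain ⟨t, -, ht, hsum⟩ := ZMod.erdos_ginzburg_ziv (s := Finset.univ) a (by simp)
  have hsum' : ∑ j, a (t.orderEmbOfFin ht j) = 0 := by
    rw [← hsum, ← Finset.sum_coe_sort t]
    exact (t.orderIsoOfFin ht).toEquiv.sum_comp (fun x => a x)
  obtain ⟨b, c, h⟩ := Fintype.exists_equiv_sub_eq_of_sum_eq_zero (by simp [ZMod.card])
    (fun j => a (t.orderEmbOfFin ht j)) hsum'
  exact ⟨t.orderEmbOfFin ht, (t.orderEmbOfFin ht).strictMono, b, c, b.bijective, c.bijective, h⟩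
end
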